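/- arXiv:0910.2997 — 3 statements merged into one kernel-verified Lean document; each statement's English description precedes it below -/
import Mathlib

section
/- Let p ∈ {2,3,5}, k ≥ 0 even, d = dim M_k(Γ_0(p)). If F ∈ M_k(Γ_0(p)) has integer Fourier coefficients and its first d coefficients (of q^0 through q^{d-1}) are divisible by p^s, then all Fourier coefficients of F are divisible by p^s. -/
open UpperHalfPlane Complex CongruenceSubgroup MatrixGroups
open scoped ModularForm Real MatrixGroups Manifold

noncomputable section

/-- `q = e^{2 π i τ}`. -/
def qexp (τ : UpperHalfPlane) : ℂ := Complex.exp (2 * π * Complex.I * τ)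

/-- `f` has the `q`-expansion `∑ c n qⁿ` at `∞`, with only finitely many negative terms. -/
def HasExpansion (f : UpperHalfPlane → ℂ) (c : ℤ → ℂ) : Prop :=
  (∃ N : ℤ, ∀ n : ℤ, n < N → c n = 0) ∧
    ∀ τ : UpperHalfPlane, HasSum (fun n : ℤ => c n * qexp τ ^ n) (f τ)

/-- Weakly holomorphic modular forms of weight `k` on `Γ`, together with their
Fourier coefficients. -/
structure WhmForm (Γ : Subgroup SL(2, ℤ)) (k : ℤ) where
  toFun : UpperHalfPlane → ℂ
  coeff : ℤ → ℂ
  holo : MDifferentiable 𝓘(ℂ) 𝓘(ℂ) toFun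
  slash_eq : ∀ γ ∈ Γ, toFun ∣[k] γ = toFun
  expansion : HasExpansion toFun coeff

/-- `f = q^{-m} + O(q^{ℓ+1})`. -/
def IsBasisElt {Γ : Subgroup SL(2, ℤ)} (k ℓ m : ℤ) (f : WhmForm Γ k) : Prop :=
  f.coeff (-m) = 1 ∧ ∀ n : ℤ, n ≠ -m → n ≤ ℓ → f.coeff n = 0

/-- multiplication of a point of the upper half plane by a positive real number. -/
def rscale (a : ℝ) (ha : 0 < a) (τ : UpperHalfPlane) : UpperHalfPlane :=
  ⟨a * τ, by simpa [Complex.mul_im] using mul_pos ha τ.2⟩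

/-- `τ ↦ -1/τ` on the upper half plane. -/
def neginv (τ : UpperHalfPlane) : UpperHalfPlane :=
  ⟨(-(τ : ℂ))⁻¹, τ.im_inv_neg_coe_pos⟩

/-- `f` has the holomorphic `q`-expansion `∑_{n ≥ 0} c n qⁿ` at `∞`. -/
def HasHoloExpansion (f : UpperHalfPlane → ℂ) (c : ℕ → ℂ) : Prop :=
  ∀ τ : UpperHalfPlane, HasSum (fun n : ℕ => c n * qexp τ ^ n) (f τ)

open ModularGroup Matrix SpecialLinearGroup

/-- The diagonal matrix with entries `a, b` as an element of `GL(2, ℝ)`. -/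
def diagGL (a b : ℝ) (h : a * b ≠ 0) : GL (Fin 2) ℝ :=
  Matrix.GeneralLinearGroup.mkOfDetNeZero !![a, 0; 0, b] (by simpa [Matrix.det_fin_two] using h)

lemma coe_diagGL (a b : ℝ) (h : a * b ≠ 0) :
    (diagGL a b h : Matrix (Fin 2) (Fin 2) ℝ) = !![a, 0; 0, b] := rfl

lemma Gamma0_le_SL (p : ℕ) :
    ((Gamma0 p : Subgroup SL(2, ℤ)) : Subgroup (GL (Fin 2) ℝ)) ≤ 𝒮ℒ := by
  rintro _ ⟨γ, -, rfl⟩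
  exact ⟨γ, rfl⟩

section LevelRaising

variable (p : ℕ) [NeZero p]

/-- The matrix `diag(p, 1)`, whose slash action sends `f` to a multiple of `f (p τ)`. -/
def raiseGL : GL (Fin 2) ℝ := diagGL p 1 (by simpa using NeZero.ne p)

lemma exists_raiseGL_mul {γ : SL(2, ℤ)} (hγ : γ ∈ Gamma0 p) :
    ∃ γ' : SL(2, ℤ), raiseGL p * mapGL ℝ γ = mapGL ℝ γ' * raiseGL p ∧
      γ' 1 0 * p = γ 1 0 ∧ γ' 1 1 = γ 1 1 := by
  rw [Gamma0_mem, ZMod.intCast_zmod_eq_zero_iff_dvd] at hγ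
  obtain ⟨c, hc⟩ := hγ
  have hdet := γ.det_coe
  rw [Matrix.det_fin_two, hc] at hdet
  obtain ⟨γ', h00, h01, h10, h11⟩ : ∃ γ' : SL(2, ℤ), γ' 0 0 = γ 0 0 ∧ γ' 0 1 = p * γ 0 1 ∧
      γ' 1 0 = c ∧ γ' 1 1 = γ 1 1 := by
    refine ⟨⟨!![γ 0 0, p * γ 0 1; c, γ 1 1], ?_⟩, rfl, rfl, rfl, rfl⟩
    rw [Matrix.det_fin_two_of]
    linear_combination hdet
  refine ⟨γ', ?_, by rw [h10, hc, mul_comm], h11⟩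
  ext i j
  have hc' : ((γ 1 0 : ℤ) : ℝ) = p * c := by exact_mod_cast hc
  fin_cases i <;> fin_cases j <;>
    simp [raiseGL, coe_diagGL, Matrix.mul_apply, Fin.sum_univ_two, mapGL_coe_matrix, hc', h00,
      h01, h10, h11, mul_comm]

lemma slash_raiseGL_apply (f : ℍ → ℂ) (k : ℤ) (τ : ℍ) :
    (f ∣[k] raiseGL p) τ = (p : ℂ) ^ (k - 1) * f (raiseGL p • τ) := by
  have hp : (0 : ℝ) < p := by exact_mod_cast Nat.pos_of_ne_zero (NeZero.ne p)
  have hdet : (raiseGL p).det.val = p := by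
    simp [raiseGL, coe_diagGL, Matrix.det_fin_two]
  rw [ModularForm.slash_apply, hdet]
  simp [σ, denom, raiseGL, coe_diagGL, Matrix.det_fin_two, hp, mul_comm]

lemma coe_raiseGL_smul (τ : ℍ) : ((raiseGL p • τ : ℍ) : ℂ) = p * τ := by
  have hp : (0 : ℝ) < p := by exact_mod_cast Nat.pos_of_ne_zero (NeZero.ne p)
  rw [UpperHalfPlane.coe_smul_of_det_pos]
  · simp [num, denom, raiseGL, coe_diagGL]
  · simpa [raiseGL, coe_diagGL, Matrix.det_fin_two] using Nat.pos_of_ne_zero (NeZero.ne p)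

lemma qParam_raiseGL_smul (τ : ℍ) :
    Function.Periodic.qParam 1 (raiseGL p • τ : ℍ) = Function.Periodic.qParam 1 τ ^ p := by
  rw [Function.Periodic.qParam, Function.Periodic.qParam, ← Complex.exp_nat_mul,
    coe_raiseGL_smul]
  congr 1
  push_cast
  ring

open ConjAct Pointwise in
lemma Gamma0_le_conj_raiseGL :
    ((Gamma0 p : Subgroup SL(2, ℤ)) : Subgroup (GL (Fin 2) ℝ)) ≤
      toConjAct (raiseGL p)⁻¹ • 𝒮ℒ := by
  rintro _ ⟨γ, hγ, rfl⟩
  obtain ⟨γ', h, -, -⟩ := exists_raiseGL_mul p hγ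
  rw [map_inv, Subgroup.mem_inv_pointwise_smul_iff, toConjAct_smul, h, mul_inv_cancel_right]
  exact ⟨γ', rfl⟩

/-- Restriction of a modular form to a smaller group. -/
def ModularForm.ofLE {Γ Γ' : Subgroup (GL (Fin 2) ℝ)} {k : ℤ} (h : Γ' ≤ Γ)
    (f : ModularForm Γ k) : ModularForm Γ' k where
  toFun := f
  slash_action_eq' γ hγ := f.slash_action_eq' γ (h hγ)
  holo' := f.holo'
  bdd_at_cusps' hc := f.bdd_at_cusps' (hc.mono h)

/-- The `q`-expansion of `f (p τ)`. -/
lemma hasSum_raiseGL {f : ℍ → ℂ} {c : ℕ → ℂ}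
    (hf : ∀ τ : ℍ, HasSum (fun m ↦ c m • Function.Periodic.qParam 1 τ ^ m) (f τ)) (τ : ℍ) :
    HasSum (fun m ↦ (if p ∣ m then c (m / p) else 0) • Function.Periodic.qParam 1 τ ^ m)
      (f (raiseGL p • τ)) := by
  have hp := Nat.pos_of_ne_zero (NeZero.ne p)
  have hinj : Function.Injective (fun m : ℕ ↦ p * m) := fun a b h ↦
    Nat.eq_of_mul_eq_mul_left hp h
  rw [← hinj.hasSum_iff]
  · convert! hf (raiseGL p • τ) using 2 with m
    simp [Nat.mul_div_cancel_left m hp, qParam_raiseGL_smul, pow_mul]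
  · intro m hm
    have : ¬ p ∣ m := fun ⟨a, ha⟩ ↦ hm ⟨a, ha.symm⟩
    simp [this]

end LevelRaising

lemma sub_slash (k : ℤ) (f g : ℍ → ℂ) (γ : SL(2, ℤ)) :
    (f - g) ∣[k] γ = f ∣[k] γ - g ∣[k] γ := by
  rw [sub_eq_add_neg, SlashAction.add_slash, SlashAction.neg_slash, ← sub_eq_add_neg]

lemma sub_slash_GL (k : ℤ) (f g : ℍ → ℂ) (γ : GL (Fin 2) ℝ) :
    (f - g) ∣[k] γ = f ∣[k] γ - g ∣[k] γ := by
  rw [sub_eq_add_neg, SlashAction.add_slash, SlashAction.neg_slash, ← sub_eq_add_neg]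

section WeightTwo

variable (p : ℕ) [NeZero p]

open EisensteinSeries

lemma D2_slash_raiseGL {γ γ' : SL(2, ℤ)} (h : γ' 1 0 * p = γ 1 0) (h' : γ' 1 1 = γ 1 1) :
    D2 γ' ∣[(2 : ℤ)] raiseGL p = D2 γ := by
  ext τ
  have h1 : ((γ 1 0 : ℤ) : ℂ) = γ' 1 0 * p := by exact_mod_cast h.symm
  rw [slash_raiseGL_apply, D2, D2]
  have : denom γ' (raiseGL p • τ : ℍ) = denom γ τ := by
    simp only [denom, coe_raiseGL_smul]
    simp [h1, h']
    ring
  rw [this, h1]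
  norm_num
  ring

/-- `p E₂(p τ) - E₂(τ)`. -/
def E2Diff : ℍ → ℂ := E2 ∣[(2 : ℤ)] raiseGL p - E2

lemma E2Diff_slash {γ : SL(2, ℤ)} (hγ : γ ∈ Gamma0 p) : E2Diff p ∣[(2 : ℤ)] γ = E2Diff p := by
  obtain ⟨γ', h, h10, h11⟩ := exists_raiseGL_mul p hγ
  have key : (E2 ∣[(2 : ℤ)] raiseGL p) ∣[(2 : ℤ)] γ =
      E2 ∣[(2 : ℤ)] raiseGL p - (1 / (2 * riemannZeta 2)) • D2 γ := by
    rw [ModularForm.SL_slash]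
    change (E2 ∣[(2 : ℤ)] raiseGL p) ∣[(2 : ℤ)] mapGL ℝ γ = _
    have h2 := E2_slash_action γ'
    rw [ModularForm.SL_slash] at h2
    change E2 ∣[(2 : ℤ)] mapGL ℝ γ' = _ at h2
    rw [← SlashAction.slash_mul, h, SlashAction.slash_mul, h2, sub_slash_GL,
      ← D2_slash_raiseGL p h10 h11]
    congr 1
    ext τ
    simp only [slash_raiseGL_apply, Pi.smul_apply, smul_eq_mul]
    ring
  rw [E2Diff, sub_slash, key, E2_slash_action]
  abel

lemma isBoundedAtImInfty_E2_slash_S : IsBoundedAtImInfty (E2 ∣[(2 : ℤ)] S) := by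
  rw [E2_slash_action]
  refine isBoundedAtImInfty_E2.sub ?_
  have hD : IsBoundedAtImInfty (D2 S) := by
    rw [UpperHalfPlane.isBoundedAtImInfty_iff]
    refine ⟨2 * π, 1, fun z hz ↦ ?_⟩
    have h1 : 1 ≤ ‖(z : ℂ)‖ := hz.trans ((le_abs_self _).trans (Complex.abs_im_le_norm z))
    rw [D2_S, norm_div]
    simp only [norm_mul, Complex.norm_I, Complex.norm_ofNat, Complex.norm_real, Real.norm_eq_abs,
      abs_of_pos Real.pi_pos, mul_one]
    exact div_le_self (by positivity) h1
  exact hD.const_smul_left _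

end WeightTwo

section WeightTwoForm

variable (p : ℕ) [hp : Fact p.Prime]

open EisensteinSeries

lemma raiseGL_mul_S : raiseGL p * mapGL ℝ S =
    mapGL ℝ S * diagGL 1 p (by simpa using hp.out.ne_zero) := by
  ext i j
  fin_cases i <;> fin_cases j <;>
    simp [raiseGL, coe_diagGL, Matrix.mul_apply, Fin.sum_univ_two, mapGL_coe_matrix, coe_S]

lemma isBoundedAtImInfty_E2Diff_slash_S : IsBoundedAtImInfty (E2Diff p ∣[(2 : ℤ)] S) := by
  rw [E2Diff, sub_slash]
  refine Asymptotics.IsBigO.sub ?_ isBoundedAtImInfty_E2_slash_S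
  rw [ModularForm.SL_slash]
  change IsBoundedAtImInfty ((E2 ∣[(2 : ℤ)] raiseGL p) ∣[(2 : ℤ)] mapGL ℝ S)
  rw [← SlashAction.slash_mul, raiseGL_mul_S, SlashAction.slash_mul]
  refine IsBoundedAtImInfty.slash _ (by simp [coe_diagGL]) ?_
  have := isBoundedAtImInfty_E2_slash_S
  rwa [ModularForm.SL_slash] at this

lemma isBoundedAtImInfty_E2Diff : IsBoundedAtImInfty (E2Diff p) := by
  refine Asymptotics.IsBigO.sub ?_ isBoundedAtImInfty_E2
  exact IsBoundedAtImInfty.slash _ (by simp [raiseGL, coe_diagGL]) isBoundedAtImInfty_E2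

/-- Coset representatives for `Γ₀(p)`, with `p` prime. -/
lemma exists_mul_S_mul_T_zpow {γ : SL(2, ℤ)} (hγ : γ ∉ Gamma0 p) :
    ∃ g ∈ Gamma0 p, ∃ j : ℤ, γ = g * S * T ^ j := by
  have hc : ((γ 1 0 : ℤ) : ZMod p) ≠ 0 := by rwa [Gamma0_mem] at hγ
  refine ⟨γ * (T ^ (((γ 1 1 : ZMod p) / (γ 1 0 : ZMod p)).val : ℤ))⁻¹ * S⁻¹, ?_,
    (((γ 1 1 : ZMod p) / (γ 1 0 : ZMod p)).val : ℤ), by group⟩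
  have h10 (m : ℤ) : (γ * (T ^ m)⁻¹ * S⁻¹) 1 0 = γ 1 0 * m - γ 1 1 := by
    have : (γ * (T ^ m)⁻¹ * S⁻¹).1 = γ.1 * (T ^ m).1.adjugate * S.1.adjugate := rfl
    rw [this, coe_T_zpow, coe_S]
    simp [Matrix.mul_apply, Fin.sum_univ_two, Matrix.adjugate_fin_two]
    ring
  rw [Gamma0_mem, h10]
  simp [mul_div_cancel₀ _ hc]

lemma isBoundedAtImInfty_E2Diff_slash (γ : SL(2, ℤ)) :
    IsBoundedAtImInfty (E2Diff p ∣[(2 : ℤ)] γ) := by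
  by_cases hγ : γ ∈ Gamma0 p
  · rw [E2Diff_slash p hγ]
    exact isBoundedAtImInfty_E2Diff p
  · obtain ⟨g, hg, j, rfl⟩ := exists_mul_S_mul_T_zpow p hγ
    rw [SlashAction.slash_mul, SlashAction.slash_mul, E2Diff_slash p hg, ModularForm.SL_slash]
    refine IsBoundedAtImInfty.slash _ ?_ (isBoundedAtImInfty_E2Diff_slash_S p)
    change ((mapGL ℝ (T ^ j) : GL (Fin 2) ℝ) : Matrix (Fin 2) (Fin 2) ℝ) 1 0 = 0
    have : (T ^ j).1 1 0 = 0 := by simp [coe_T_zpow]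
    rw [mapGL_coe_matrix, map_apply_coe, RingHom.mapMatrix_apply, Matrix.map_apply, this, map_zero]

/-- The modular form `p E₂(p τ) - E₂(τ)` of weight two on `Γ₀(p)`. -/
def E2DiffForm : ModularForm (Gamma0 p) 2 where
  toFun := E2Diff p
  slash_action_eq' := by
    rintro _ ⟨γ, hγ, rfl⟩
    have := E2Diff_slash p hγ
    rwa [ModularForm.SL_slash] at this
  holo' := (E2_mdifferentiable.slash _ _).sub E2_mdifferentiable
  bdd_at_cusps' {c} hc := by
    rw [Subgroup.IsArithmetic.isCusp_iff_isCusp_SL2Z] at hc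
    rw [OnePoint.isBoundedAt_iff_forall_SL2Z hc]
    exact fun γ _ ↦ isBoundedAtImInfty_E2Diff_slash p γ

lemma coe_E2DiffForm : ⇑(E2DiffForm p) = E2Diff p := rfl

lemma hasSum_E2Diff (τ : ℍ) :
    HasSum (fun m ↦ ((p : ℂ) * (if p ∣ m then
        (if m / p = 0 then (1 : ℂ) else -24 * ArithmeticFunction.sigma 1 (m / p)) else 0) -
        (if m = 0 then (1 : ℂ) else -24 * ArithmeticFunction.sigma 1 m)) •
      Function.Periodic.qParam 1 τ ^ m) (E2Diff p τ) := by
  have h2 (z : ℍ) : HasSum (fun m : ℕ ↦ (if m = 0 then (1 : ℂ) else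
      -24 * ArithmeticFunction.sigma 1 m) • Function.Periodic.qParam 1 z ^ m) (E2 z) := by
    simpa [Function.Periodic.qParam] using hasSum_qExpansion_E2 z
  have := ((hasSum_raiseGL p h2 τ).mul_left (p : ℂ)).sub (h2 τ)
  convert! this using 2 with m
  · simp only [smul_eq_mul]
    ring
  · simp [E2Diff, slash_raiseGL_apply]

end WeightTwoForm

/-- The integral power series `P` is the `q`-expansion of a form of weight `k` on `Γ₀(p)`. -/
def IsIntForm (p : ℕ) (k : ℤ) (P : PowerSeries ℤ) : Prop :=
  ∃ F : ModularForm (Gamma0 p) k, qExpansion 1 F = P.map (Int.castRingHom ℂ)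

lemma one_mem_strictPeriods_Gamma0 (p : ℕ) :
    (1 : ℝ) ∈ ((Gamma0 p : Subgroup SL(2, ℤ)) : Subgroup (GL (Fin 2) ℝ)).strictPeriods := by
  simp

namespace IsIntForm

variable {p : ℕ} {k l : ℤ} {P Q : PowerSeries ℤ}

lemma of_hasSum (F : ModularForm (Gamma0 p) k)
    (h : ∀ τ : ℍ, HasSum (fun m ↦ (P.coeff m : ℂ) • Function.Periodic.qParam 1 τ ^ m) (F τ)) :
    IsIntForm p k P := by
  refine ⟨F, ?_⟩
  ext m
  rw [← ModularFormClass.qExpansion_coeff_unique one_pos (one_mem_strictPeriods_Gamma0 p) h m]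
  simp

lemma add (hP : IsIntForm p k P) (hQ : IsIntForm p k Q) : IsIntForm p k (P + Q) := by
  obtain ⟨F, hF⟩ := hP
  obtain ⟨G, hG⟩ := hQ
  refine ⟨F + G, ?_⟩
  rw [map_add, ← hF, ← hG, FunLike.coe_add]
  exact ModularForm.qExpansion_add one_pos (one_mem_strictPeriods_Gamma0 p) F G

lemma sub (hP : IsIntForm p k P) (hQ : IsIntForm p k Q) : IsIntForm p k (P - Q) := by
  obtain ⟨F, hF⟩ := hP
  obtain ⟨G, hG⟩ := hQ
  refine ⟨F - G, ?_⟩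
  rw [map_sub, ← hF, ← hG, FunLike.coe_sub]
  exact ModularForm.qExpansion_sub one_pos (one_mem_strictPeriods_Gamma0 p) F G

lemma zsmul (n : ℤ) (hP : IsIntForm p k P) : IsIntForm p k (n • P) := by
  obtain ⟨F, hF⟩ := hP
  refine ⟨(n : ℂ) • F, ?_⟩
  have := ModularForm.qExpansion_smul one_pos (one_mem_strictPeriods_Gamma0 p) (n : ℂ) F
  rw [show ⇑((n : ℂ) • F) = (n : ℂ) • ⇑F from rfl, this, hF]
  ext m
  simp [map_zsmul, -zsmul_eq_mul]
  simp

lemma of_zsmul {n : ℤ} (hn : n ≠ 0) (hP : IsIntForm p k (n • P)) : IsIntForm p k P := by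
  obtain ⟨F, hF⟩ := hP
  refine ⟨(n : ℂ)⁻¹ • F, ?_⟩
  have := ModularForm.qExpansion_smul one_pos (one_mem_strictPeriods_Gamma0 p) (n : ℂ)⁻¹ F
  rw [show ⇑((n : ℂ)⁻¹ • F) = (n : ℂ)⁻¹ • ⇑F from rfl, this, hF]
  ext m
  have : (n : ℂ) ≠ 0 := by exact_mod_cast hn
  simp only [map_smul, map_zsmul]
  simp [this]

lemma mul (hP : IsIntForm p k P) (hQ : IsIntForm p l Q) : IsIntForm p (k + l) (P * Q) := by
  obtain ⟨F, hF⟩ := hP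
  obtain ⟨G, hG⟩ := hQ
  refine ⟨F.mul G, ?_⟩
  rw [map_mul, ← hF, ← hG]
  exact ModularForm.qExpansion_mul one_pos (one_mem_strictPeriods_Gamma0 p) F G

lemma pow (hP : IsIntForm p k P) (n : ℕ) : IsIntForm p (n * k) (P ^ n) := by
  obtain ⟨F, hF⟩ := hP
  refine ⟨F.pow n, ?_⟩
  rw [map_pow, ← hF]
  exact ModularForm.qExpansion_pow one_pos (one_mem_strictPeriods_Gamma0 p) F n

lemma zero : IsIntForm p k 0 :=
  ⟨0, by rw [FunLike.coe_zero, qExpansion_zero, map_zero]⟩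

end IsIntForm

/-- The series `P(q ^ p)`. -/
def levelRaise (p : ℕ) (P : PowerSeries ℤ) : PowerSeries ℤ :=
  PowerSeries.mk fun n ↦ if p ∣ n then P.coeff (n / p) else 0

lemma coeff_levelRaise (p : ℕ) (P : PowerSeries ℤ) (n : ℕ) :
    (levelRaise p P).coeff n = if p ∣ n then P.coeff (n / p) else 0 :=
  PowerSeries.coeff_mk _ _

/-- The generating series of the divisor sums `σ k`. -/
def sigmaSeries (k : ℕ) : PowerSeries ℤ :=
  PowerSeries.mk fun n ↦ ArithmeticFunction.sigma k n

lemma coeff_sigmaSeries (k n : ℕ) : (sigmaSeries k).coeff n = ArithmeticFunction.sigma k n :=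
  PowerSeries.coeff_mk _ _

section LevelOne

variable (p : ℕ) {k : ℤ} {P : PowerSeries ℤ}

lemma isIntForm_of_levelOne (F : ModularForm 𝒮ℒ k)
    (hF : ∀ m, (qExpansion 1 F).coeff m = (P.coeff m : ℂ)) : IsIntForm p k P := by
  refine IsIntForm.of_hasSum (ModularForm.ofLE (Gamma0_le_SL p) F) fun τ ↦ ?_
  simpa only [hF, smul_eq_mul] using!
    ModularForm.hasSum_qExpansion F one_pos one_mem_strictPeriods_SL τ

lemma isIntForm_levelRaise [NeZero p] (F : ModularForm 𝒮ℒ k)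
    (hF : ∀ m, (qExpansion 1 F).coeff m = (P.coeff m : ℂ)) : IsIntForm p k (levelRaise p P) := by
  refine IsIntForm.of_hasSum (((p : ℂ) ^ (k - 1))⁻¹ •
    ModularForm.ofLE (Gamma0_le_conj_raiseGL p) (ModularForm.translate F (raiseGL p))) fun τ ↦ ?_
  have hp : (p : ℂ) ^ (k - 1) ≠ 0 := zpow_ne_zero _ (by simpa using NeZero.ne p)
  have h1 := hasSum_raiseGL p (f := F) (c := fun m ↦ (P.coeff m : ℂ))
    (by simpa only [hF, smul_eq_mul] using!
      ModularForm.hasSum_qExpansion F one_pos one_mem_strictPeriods_SL) τ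
  convert! h1 using 1
  · funext m
    rw [coeff_levelRaise]
    split_ifs <;> simp
  · change ((p : ℂ) ^ (k - 1))⁻¹ * (⇑F ∣[k] raiseGL p) τ = _
    rw [slash_raiseGL_apply, inv_mul_cancel_left₀ hp]

end LevelOne

section EisensteinSeries

lemma E₄_coeff (m : ℕ) : (qExpansion 1 ModularForm.E₄).coeff m =
    (((1 + 240 • sigmaSeries 3 : PowerSeries ℤ).coeff m : ℤ) : ℂ) := by
  rw [ModularForm.E₄, EisensteinSeries.E_qExpansion_coeff _ ⟨2, rfl⟩,
    show bernoulli 4 = -1 / 30 by decide +kernel]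
  rcases eq_or_ne m 0 with rfl | hm
  · simp [sigmaSeries]
  · simp only [hm, sigmaSeries, PowerSeries.coeff_one, map_add, map_nsmul,
      PowerSeries.coeff_mk]
    norm_num

lemma E₆_coeff (m : ℕ) : (qExpansion 1 ModularForm.E₆).coeff m =
    (((1 - 504 • sigmaSeries 5 : PowerSeries ℤ).coeff m : ℤ) : ℂ) := by
  rw [ModularForm.E₆, EisensteinSeries.E_qExpansion_coeff _ ⟨3, rfl⟩,
    show bernoulli 6 = 1 / 42 by decide +kernel]
  rcases eq_or_ne m 0 with rfl | hm
  · simp [sigmaSeries]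
  · simp only [hm, sigmaSeries, PowerSeries.coeff_one, map_sub, map_nsmul,
      PowerSeries.coeff_mk]
    norm_num

/-- The series `∑ (σ₁(n) - p σ₁(n / p)) qⁿ`. -/
def seriesA (p : ℕ) : PowerSeries ℤ := sigmaSeries 1 - p • levelRaise p (sigmaSeries 1)

/-- The series `∑ (σₖ(n) - σₖ(n / p)) qⁿ`. -/
def seriesDiff (p k : ℕ) : PowerSeries ℤ := sigmaSeries k - levelRaise p (sigmaSeries k)

lemma levelRaise_one_add (p n : ℕ) (hp : p ≠ 0) (P : PowerSeries ℤ) :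
    levelRaise p (1 + n • P) = 1 + n • levelRaise p P := by
  ext m
  simp only [coeff_levelRaise, map_add, map_nsmul, PowerSeries.coeff_one]
  split_ifs with h1 h2 h3 h3
  · rfl
  · exact absurd ((Nat.div_eq_zero_iff_lt (Nat.pos_of_ne_zero hp)).1 h2)
      (by simpa using Nat.le_of_dvd (Nat.pos_of_ne_zero h3) h1)
  · simp [h3] at h2
  · rfl
  · simp_all
  · simp

lemma levelRaise_one_sub (p n : ℕ) (hp : p ≠ 0) (P : PowerSeries ℤ) :
    levelRaise p (1 - n • P) = 1 - n • levelRaise p P := by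
  have := levelRaise_one_add p n hp (-P)
  have h : levelRaise p (-P) = - levelRaise p P := by
    ext m
    simp only [coeff_levelRaise, map_neg]
    split_ifs <;> simp
  rw [h] at this
  simpa [sub_eq_add_neg] using this

lemma isIntForm_seriesDiff_three (p : ℕ) [NeZero p] : IsIntForm p 4 (seriesDiff p 3) := by
  refine IsIntForm.of_zsmul (n := 240) (by norm_num) ?_
  have := (isIntForm_of_levelOne p _ E₄_coeff).sub (isIntForm_levelRaise p _ E₄_coeff)
  rw [levelRaise_one_add _ _ (NeZero.ne p)] at this
  convert this using 1
  simp only [seriesDiff, zsmul_eq_mul, nsmul_eq_mul]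
  push_cast
  ring

lemma isIntForm_seriesDiff_five (p : ℕ) [NeZero p] : IsIntForm p 6 (seriesDiff p 5) := by
  refine IsIntForm.of_zsmul (n := -504) (by norm_num) ?_
  have := (isIntForm_of_levelOne p _ E₆_coeff).sub (isIntForm_levelRaise p _ E₆_coeff)
  rw [levelRaise_one_sub _ _ (NeZero.ne p)] at this
  convert this using 1
  simp only [seriesDiff, zsmul_eq_mul, nsmul_eq_mul]
  push_cast
  ring

lemma isIntForm_one_add_seriesA (p e : ℕ) [hp : Fact p.Prime] (he : (p - 1) * e = 24) :
    IsIntForm p 2 (1 + e • seriesA p) := by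
  have hp2 := hp.out.two_le
  have he' : ((p : ℤ) - 1) * e = 24 := by
    have := congrArg (Nat.cast : ℕ → ℤ) he
    rwa [Nat.cast_mul, Nat.cast_sub (by lia), Nat.cast_one] at this
  refine IsIntForm.of_zsmul (n := (p : ℤ) - 1) (by lia) ?_
  refine IsIntForm.of_hasSum (E2DiffForm p) fun τ ↦ ?_
  rw [coe_E2DiffForm]
  convert! hasSum_E2Diff p τ using 3 with m
  have h24 : ((p : ℂ) - 1) * e = 24 := by exact_mod_cast he'
  rcases eq_or_ne m 0 with rfl | hm
  · simp only [sigmaSeries, seriesA, coeff_levelRaise, map_zsmul, map_add, map_nsmul, map_sub,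
      PowerSeries.coeff_mk, PowerSeries.coeff_one]
    simp
  · simp only [sigmaSeries, seriesA, coeff_levelRaise, hm, map_zsmul, map_add, map_nsmul,
      map_sub, PowerSeries.coeff_mk, PowerSeries.coeff_one, if_false]
    split_ifs with h1 h2
    · rw [Nat.div_eq_zero_iff_lt (by lia)] at h2
      exact absurd h2 (by simpa using Nat.le_of_dvd (Nat.pos_of_ne_zero hm) h1)
    · simp only [← h24]
      simp
      ring
    · simp only [← h24]
      simp
      ring

end EisensteinSeries

/-- The power series `P` has the form `Xⁿ + O(Xⁿ⁺¹)`. -/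
def HasLead (n : ℕ) (P : PowerSeries ℤ) : Prop :=
  PowerSeries.X ^ n ∣ P ∧ P.coeff n = 1

namespace HasLead

lemma mul {m n : ℕ} {P Q : PowerSeries ℤ} (hP : HasLead m P) (hQ : HasLead n Q) :
    HasLead (m + n) (P * Q) := by
  obtain ⟨⟨P, rfl⟩, hP⟩ := hP
  obtain ⟨⟨Q, rfl⟩, hQ⟩ := hQ
  have h : PowerSeries.X ^ m * P * (PowerSeries.X ^ n * Q) =
    PowerSeries.X ^ (m + n) * (P * Q) := by ring
  rw [PowerSeries.coeff_X_pow_mul', if_pos le_rfl, Nat.sub_self] at hP hQ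
  refine ⟨h ▸ dvd_mul_right _ _, ?_⟩
  rw [h, PowerSeries.coeff_X_pow_mul', if_pos le_rfl, Nat.sub_self]
  simp_all

lemma one : HasLead 0 1 := ⟨by simp, by simp⟩

lemma pow {n : ℕ} {P : PowerSeries ℤ} (hP : HasLead n P) (m : ℕ) : HasLead (m * n) (P ^ m) := by
  induction m with
  | zero => simpa using one
  | succ m ih => rw [pow_succ, add_one_mul]; exact ih.mul hP

end HasLead

lemma hasLead_one_add_seriesA (p e : ℕ) : HasLead 0 (1 + e • seriesA p) := by
  refine ⟨by simp, ?_⟩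
  simp only [seriesA, map_add, map_nsmul, map_sub, coeff_sigmaSeries, coeff_levelRaise]
  simp

lemma hasLead_seriesDiff (p k : ℕ) (hp : 1 < p) : HasLead 1 (seriesDiff p k) := by
  constructor
  · rw [PowerSeries.X_pow_dvd_iff]
    intro m hm
    obtain rfl : m = 0 := by lia
    simp only [seriesDiff, map_sub, coeff_sigmaSeries, coeff_levelRaise]
    simp
  · simp only [seriesDiff, map_sub, coeff_sigmaSeries, coeff_levelRaise, Nat.dvd_one, hp.ne']
    simp

lemma dvd_sigma_sub_sigma {N k l : ℕ} (h : ∀ a : ZMod N, a ^ k - a ^ l = 0) (n : ℕ) :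
    (N : ℤ) ∣ (ArithmeticFunction.sigma k n : ℤ) - ArithmeticFunction.sigma l n := by
  rw [ArithmeticFunction.sigma_apply, ArithmeticFunction.sigma_apply]
  push_cast
  rw [← Finset.sum_sub_distrib]
  refine Finset.dvd_sum fun d _ ↦ ?_
  rw [← ZMod.intCast_zmod_eq_zero_iff_dvd]
  exact_mod_cast h d

lemma exists_eq_zsmul_of_dvd {n : ℤ} {P : PowerSeries ℤ} (h : ∀ m, n ∣ P.coeff m) :
    ∃ Q, P = n • Q := by
  choose c hc using h
  refine ⟨PowerSeries.mk c, ?_⟩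
  ext m
  rw [map_zsmul, PowerSeries.coeff_mk, hc, smul_eq_mul]

lemma levelRaise_add (p : ℕ) (P Q : PowerSeries ℤ) :
    levelRaise p (P + Q) = levelRaise p P + levelRaise p Q := by
  ext m
  simp only [coeff_levelRaise, map_add]
  split_ifs <;> simp

lemma levelRaise_zsmul (p : ℕ) (n : ℤ) (P : PowerSeries ℤ) :
    levelRaise p (n • P) = n • levelRaise p P := by
  ext m
  simp only [coeff_levelRaise, map_zsmul]
  split_ifs <;> simp

lemma exists_isIntForm_three : ∃ P, IsIntForm 3 6 P ∧ HasLead 2 P := by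
  obtain ⟨D, hD⟩ := exists_eq_zsmul_of_dvd (n := 24) (P := sigmaSeries 5 - sigmaSeries 3)
    (fun m ↦ by
      rw [map_sub, coeff_sigmaSeries, coeff_sigmaSeries]
      exact dvd_sigma_sub_sigma (N := 24) (by decide) m)
  have : Fact (Nat.Prime 3) := ⟨Nat.prime_three⟩
  have hS : sigmaSeries 5 = sigmaSeries 3 + (24 : ℤ) • D := by rw [← hD]; ring
  have hV : levelRaise 3 (sigmaSeries 5) =
      levelRaise 3 (sigmaSeries 3) + (24 : ℤ) • levelRaise 3 D := by
    rw [hS, levelRaise_add, levelRaise_zsmul]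
  have hDm (m : ℕ) : 24 * D.coeff m =
      ArithmeticFunction.sigma 5 m - ArithmeticFunction.sigma 3 m := by
    rw [← coeff_sigmaSeries, ← coeff_sigmaSeries, ← map_sub, hD, map_zsmul, smul_eq_mul]
  refine ⟨(2 : ℤ) • (D - levelRaise 3 D) - seriesA 3 * seriesDiff 3 3, ?_, ?_, ?_⟩
  · refine IsIntForm.of_zsmul (n := 12) (by norm_num) ?_
    have := (isIntForm_seriesDiff_five 3).sub
      ((isIntForm_one_add_seriesA 3 12 (by norm_num)).mul (isIntForm_seriesDiff_three 3))
    convert this using 1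
    simp only [seriesDiff, hV]
    rw [hS]
    simp only [zsmul_eq_mul, nsmul_eq_mul]
    push_cast
    ring
  · rw [PowerSeries.X_pow_dvd_iff]
    intro m hm
    simp only [map_sub, map_zsmul, PowerSeries.coeff_mul, coeff_levelRaise, seriesA, seriesDiff,
      map_nsmul, coeff_sigmaSeries]
    interval_cases m
    · simp
    · have h1 : D.coeff 1 = 0 := by simpa using hDm 1
      simp [Finset.Nat.antidiagonal_succ, h1]
  · have h2 : D.coeff 2 = 1 := by
      have := hDm 2
      rw [show ArithmeticFunction.sigma 5 2 = 33 by decide,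
        show ArithmeticFunction.sigma 3 2 = 9 by decide] at this
      lia
    simp only [map_sub, map_zsmul, PowerSeries.coeff_mul, coeff_levelRaise, seriesA, seriesDiff,
      map_nsmul, coeff_sigmaSeries]
    simp [Finset.Nat.antidiagonal_succ, h2]

lemma exists_isIntForm_five : ∃ P, IsIntForm 5 4 P ∧ HasLead 2 P := by
  obtain ⟨D, hD⟩ := exists_eq_zsmul_of_dvd (n := 6) (P := sigmaSeries 3 - sigmaSeries 1)
    (fun m ↦ by
      rw [map_sub, coeff_sigmaSeries, coeff_sigmaSeries]
      exact dvd_sigma_sub_sigma (N := 6) (by decide) m)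
  have : Fact (Nat.Prime 5) := ⟨Nat.prime_five⟩
  have hS : sigmaSeries 3 = sigmaSeries 1 + (6 : ℤ) • D := by rw [← hD]; ring
  have hV : levelRaise 5 (sigmaSeries 3) =
      levelRaise 5 (sigmaSeries 1) + (6 : ℤ) • levelRaise 5 D := by
    rw [hS, levelRaise_add, levelRaise_zsmul]
  have hDm (m : ℕ) : 6 * D.coeff m =
      ArithmeticFunction.sigma 3 m - ArithmeticFunction.sigma 1 m := by
    rw [← coeff_sigmaSeries, ← coeff_sigmaSeries, ← map_sub, hD, map_zsmul, smul_eq_mul]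
  refine ⟨(2 : ℤ) • D + (8 : ℤ) • levelRaise 5 (sigmaSeries 1) + (38 : ℤ) • levelRaise 5 D -
    seriesA 5 ^ 2, ?_, ?_, ?_⟩
  · refine IsIntForm.of_zsmul (n := 36) (by norm_num) ?_
    have h4 := isIntForm_levelRaise 5 _ E₄_coeff
    rw [levelRaise_one_add _ _ (by norm_num)] at h4
    have := (((isIntForm_seriesDiff_three 5).zsmul 12).add h4).sub
      ((isIntForm_one_add_seriesA 5 6 (by norm_num)).pow 2)
    convert this using 1
    simp only [seriesDiff, hV, seriesA]
    rw [hS]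
    simp only [zsmul_eq_mul, nsmul_eq_mul]
    push_cast
    ring
  · rw [PowerSeries.X_pow_dvd_iff]
    intro m hm
    simp only [map_sub, map_zsmul, map_add, sq, PowerSeries.coeff_mul, coeff_levelRaise, seriesA,
      map_nsmul, coeff_sigmaSeries]
    interval_cases m
    · have h0 : D.coeff 0 = 0 := by simpa using hDm 0
      simp at h0
      simp [h0]
    · have h1 : D.coeff 1 = 0 := by simpa using hDm 1
      simp [Finset.Nat.antidiagonal_succ, h1]
  · have h2 : D.coeff 2 = 1 := by
      have := hDm 2
      rw [show ArithmeticFunction.sigma 3 2 = 9 by decide,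
        show ArithmeticFunction.sigma 1 2 = 3 by decide] at this
      lia
    simp only [map_sub, map_zsmul, map_add, sq, PowerSeries.coeff_mul, coeff_levelRaise, seriesA,
      map_nsmul, coeff_sigmaSeries]
    simp [Finset.Nat.antidiagonal_succ, h2]

lemma exists_hasLead_two {j n : ℕ} (hn : n < j / 2 + 1) :
    ∃ P, IsIntForm 2 (2 * j) P ∧ HasLead n P := by
  have : Fact (Nat.Prime 2) := ⟨Nat.prime_two⟩
  obtain ⟨i, rfl⟩ : ∃ i, j = 2 * n + i := ⟨j - 2 * n, by lia⟩
  refine ⟨(1 + 24 • seriesA 2) ^ i * seriesDiff 2 3 ^ n, ?_, ?_⟩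
  · convert ((isIntForm_one_add_seriesA 2 24 (by norm_num)).pow i).mul
      ((isIntForm_seriesDiff_three 2).pow n) using 1
    push_cast
    ring
  · simpa using ((hasLead_one_add_seriesA 2 24).pow i).mul
      ((hasLead_seriesDiff 2 3 (by norm_num)).pow n)

lemma exists_hasLead_three {j n : ℕ} (hn : n < 2 * j / 3 + 1) :
    ∃ P, IsIntForm 3 (2 * j) P ∧ HasLead n P := by
  have : Fact (Nat.Prime 3) := ⟨Nat.prime_three⟩
  obtain ⟨Q, hQ, hQ'⟩ := exists_isIntForm_three
  obtain ⟨b, c, i, hj, rfl⟩ : ∃ b c i, j = i + 2 * b + 3 * c ∧ n = b + c * 2 :=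
    ⟨n % 2, n / 2, j - 2 * (n % 2) - 3 * (n / 2), by lia, by lia⟩
  refine ⟨(1 + 12 • seriesA 3) ^ i * seriesDiff 3 3 ^ b * Q ^ c, ?_, ?_⟩
  · convert (((isIntForm_one_add_seriesA 3 12 (by norm_num)).pow i).mul
      ((isIntForm_seriesDiff_three 3).pow b)).mul (hQ.pow c) using 1
    rw [hj]
    push_cast
    ring
  · simpa using (((hasLead_one_add_seriesA 3 12).pow i).mul
      ((hasLead_seriesDiff 3 3 (by norm_num)).pow b)).mul (hQ'.pow c)

lemma exists_hasLead_five {j n : ℕ} (hn : n < 2 * (j / 2) + 1) :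
    ∃ P, IsIntForm 5 (2 * j) P ∧ HasLead n P := by
  have : Fact (Nat.Prime 5) := ⟨Nat.prime_five⟩
  obtain ⟨Q, hQ, hQ'⟩ := exists_isIntForm_five
  obtain ⟨b, c, i, hj, rfl⟩ : ∃ b c i, j = i + 2 * b + 2 * c ∧ n = b + c * 2 :=
    ⟨n % 2, n / 2, j - 2 * (n % 2) - 2 * (n / 2), by lia, by lia⟩
  refine ⟨(1 + 6 • seriesA 5) ^ i * seriesDiff 5 3 ^ b * Q ^ c, ?_, ?_⟩
  · convert (((isIntForm_one_add_seriesA 5 6 (by norm_num)).pow i).mul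
      ((isIntForm_seriesDiff_three 5).pow b)).mul (hQ.pow c) using 1
    rw [hj]
    push_cast
    ring
  · simpa using (((hasLead_one_add_seriesA 5 6).pow i).mul
      ((hasLead_seriesDiff 5 3 (by norm_num)).pow b)).mul (hQ'.pow c)

section LevelOneVanishing

open Asymptotics Filter

/-- Divide a form of level one by the discriminant. -/
def divDelta {k : ℤ} (f : ModularForm 𝒮ℒ k) (hf : f =O[atImInfty] ModularForm.discriminant) :
    ModularForm 𝒮ℒ (k - 12) where
  toFun := f / CuspForm.discriminant
  slash_action_eq' := by
    rintro _ ⟨γ, rfl⟩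
    have hγ : (γ : GL (Fin 2) ℝ) ∈ 𝒮ℒ := ⟨γ, rfl⟩
    change (⇑f / ⇑CuspForm.discriminant) ∣[k - 12] γ = ⇑f / ⇑CuspForm.discriminant
    simp_rw [ModularForm.div_slash_SL2, ModularForm.SL_slash,
      SlashInvariantForm.slash_action_eqn _ _ hγ]
  holo' := f.holo'.div CuspForm.discriminant.holo' ModularForm.discriminant_ne_zero
  bdd_at_cusps' {c} hc := by
    rw [OnePoint.isBoundedAt_iff_forall_SL2Z (by simpa using hc)]
    intro γ _
    have hγ : (γ : GL (Fin 2) ℝ) ∈ 𝒮ℒ := ⟨γ, rfl⟩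
    have : (⇑f / ⇑CuspForm.discriminant) ∣[k - 12] γ = ⇑f / ⇑CuspForm.discriminant := by
      simp_rw [ModularForm.div_slash_SL2, ModularForm.SL_slash,
        SlashInvariantForm.slash_action_eqn _ _ hγ]
    rw [this]
    exact (div_isBoundedUnder_of_isBigO hf).isBigO_one ℝ

lemma divDelta_apply {k : ℤ} (f : ModularForm 𝒮ℒ k)
    (hf : f =O[atImInfty] ModularForm.discriminant) (τ : ℍ) :
    divDelta f hf τ = f τ / ModularForm.discriminant τ := rfl

lemma levelOne_eq_zero_of_isBigO {n : ℕ} {k : ℤ} {f : ModularForm 𝒮ℒ k}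
    (hf : f =O[atImInfty] (ModularForm.discriminant ^ n))
    (hk : k < 12 * n ∨ k = 12 * n ∧ ∃ τ, f τ = 0) : f = 0 := by
  induction n generalizing k with
  | zero =>
    ext τ
    rcases hk with hk | ⟨hk, τ₀, hτ₀⟩
    · rw [ModularFormClass.levelOne_neg_weight_eq_zero (by simpa using hk) f]
      rfl
    · obtain rfl : k = 0 := by simpa using hk
      obtain ⟨c, hc⟩ := ModularFormClass.levelOne_weight_zero_const f
      rw [hc] at hτ₀ ⊢
      exact hτ₀
  | succ n ih =>
    have hone : ModularForm.discriminant =O[atImInfty] (1 : ℍ → ℂ) :=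
      IsBigO.trans (ModularFormClass.bdd_at_infty CuspForm.discriminant)
        (isBigO_of_le _ fun τ ↦ by simp)
    have hf' : f =O[atImInfty] ModularForm.discriminant := by
      refine hf.trans ?_
      rw [pow_succ]
      exact ((hone.pow n).mul (isBigO_refl ModularForm.discriminant atImInfty)).congr
        (fun _ ↦ rfl) fun τ ↦ by simp
    have h0 : divDelta f hf' = 0 := by
      refine ih ?_ ?_
      · have := hf.mul (isBigO_refl (ModularForm.discriminant⁻¹) atImInfty)
        refine this.congr (fun τ ↦ ?_) fun τ ↦ ?_
        · simp [divDelta_apply, div_eq_mul_inv]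
        · simp [pow_succ, ModularForm.discriminant_ne_zero τ]
      · rcases hk with hk | ⟨hk, τ, hτ⟩
        · left; push_cast at hk; lia
        · right; push_cast at hk; exact ⟨by lia, τ, by simp [divDelta_apply, hτ]⟩
    ext τ
    have := DFunLike.congr_fun h0 τ
    simpa [divDelta_apply, ModularForm.discriminant_ne_zero τ] using this

lemma isBigO_discriminant_pow {f : ℍ → ℂ} {c : ℕ → ℂ} {n : ℕ}
    (hf : ∀ τ : ℍ, HasSum (fun m ↦ c m • Function.Periodic.qParam 1 τ ^ m) (f τ))
    (hc : ∀ m < n, c m = 0) : f =O[atImInfty] (ModularForm.discriminant ^ n) := by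
  have hq (τ : ℍ) : Function.Periodic.qParam 1 τ ^ n ≠ 0 :=
    pow_ne_zero _ (Complex.exp_ne_zero _)
  have hg : IsBoundedAtImInfty (fun τ : ℍ ↦ f τ / Function.Periodic.qParam 1 τ ^ n) := by
    refine isBoundedAtImInfty_of_hasSum_qExpansion (c := fun m ↦ c (m + n)) one_pos fun τ ↦ ?_
    have h1 := (hasSum_nat_add_iff' n).2 (hf τ)
    rw [Finset.sum_eq_zero (fun i hi ↦ by rw [hc i (Finset.mem_range.1 hi), zero_smul]),
      sub_zero] at h1
    convert! h1.div_const (Function.Periodic.qParam 1 τ ^ n) using 2 with m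
    simp only [smul_eq_mul, pow_add]
    field_simp [hq τ]
  have hq' : (fun τ : ℍ ↦ Function.Periodic.qParam 1 τ) =O[atImInfty]
      ModularForm.discriminant := by
    refine IsBigO.trans ?_ ModularForm.exp_isBigO_discriminant
    refine isBigO_of_le _ fun τ ↦ ?_
    simp [Function.Periodic.qParam, Complex.norm_exp]
  have hg' : (fun τ : ℍ ↦ f τ / Function.Periodic.qParam 1 τ ^ n) =O[atImInfty] (1 : ℍ → ℂ) :=
    hg.trans (isBigO_of_le _ fun τ ↦ by simp)
  refine (hg'.mul (hq'.pow n)).congr (fun τ ↦ div_mul_cancel₀ _ (hq τ)) fun τ ↦ ?_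
  simp

end LevelOneVanishing

section Norm

open Asymptotics Filter

lemma card_quotient_Gamma0_le (p : ℕ) [hp : Fact p.Prime] :
    Nat.card (𝒮ℒ ⧸ ((Gamma0 p : Subgroup SL(2, ℤ)) : Subgroup (GL (Fin 2) ℝ)).subgroupOf 𝒮ℒ) ≤
      p + 1 := by
  classical
  have hg (q : 𝒮ℒ ⧸ ((Gamma0 p : Subgroup SL(2, ℤ)) : Subgroup (GL (Fin 2) ℝ)).subgroupOf 𝒮ℒ) :
      ∃ g : SL(2, ℤ), (⟨mapGL ℝ g, g, rfl⟩ : 𝒮ℒ) = q := by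
    obtain ⟨⟨_, g, rfl⟩, rfl⟩ := QuotientGroup.mk_surjective q
    exact ⟨g, rfl⟩
  choose g hg using hg
  let φ (q : 𝒮ℒ ⧸ ((Gamma0 p : Subgroup SL(2, ℤ)) : Subgroup (GL (Fin 2) ℝ)).subgroupOf 𝒮ℒ) :
      Option (ZMod p) :=
    if (g q 1 0 : ZMod p) = 0 then none else some ((g q 0 0 : ZMod p) / (g q 1 0 : ZMod p))
  have hφ : Function.Injective φ := by
    intro q q' h
    rw [← hg q, ← hg q', QuotientGroup.eq, Subgroup.mem_subgroupOf]
    refine ⟨(g q)⁻¹ * g q', ?_, by simp⟩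
    have h10 : ((g q)⁻¹ * g q') 1 0 = g q 0 0 * g q' 1 0 - g q 1 0 * g q' 0 0 := by
      have : ((g q)⁻¹ * g q').1 = (g q).1.adjugate * (g q').1 := rfl
      rw [this]
      simp [Matrix.mul_apply, Fin.sum_univ_two, Matrix.adjugate_fin_two]
      ring
    change (g q)⁻¹ * g q' ∈ Gamma0 p
    rw [Gamma0_mem, h10]
    push_cast
    simp only [φ] at h
    split_ifs at h with h1 h2 h2
    · simp [h1, h2]
    · simpa [div_eq_div_iff h1 h2, sub_eq_zero, mul_comm] using h
  have := Nat.card_le_card_of_injective φ hφ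
  simpa [Nat.card_eq_fintype_card, ZMod.card] using this

variable {Γ : Subgroup (GL (Fin 2) ℝ)} [Γ.IsArithmetic] {k : ℤ}

lemma isBoundedAtImInfty_quotientFunc (f : ModularForm Γ k) (q : 𝒮ℒ ⧸ Γ.subgroupOf 𝒮ℒ) :
    IsBoundedAtImInfty (SlashInvariantForm.quotientFunc f q) := by
  induction q using Quotient.inductionOn with
  | h r =>
    obtain ⟨_, γ, rfl⟩ := r
    refine f.bdd_at_cusps' ?_ (mapGL ℝ γ)⁻¹ rfl
    rw [Subgroup.IsArithmetic.isCusp_iff_isCusp_SL2Z, isCusp_SL2Z_iff']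
    exact ⟨γ⁻¹, by simp⟩

lemma norm_isBigO (f : ModularForm Γ k) {g : ℍ → ℂ} (hf : f =O[atImInfty] g) :
    ModularForm.norm 𝒮ℒ f =O[atImInfty] g := by
  classical
  rw [ModularForm.coe_norm]
  let := Fintype.ofFinite (𝒮ℒ ⧸ Γ.subgroupOf 𝒮ℒ)
  let q₁ : 𝒮ℒ ⧸ Γ.subgroupOf 𝒮ℒ := ⟦1⟧
  have h1 : SlashInvariantForm.quotientFunc f q₁ =O[atImInfty] g := by
    simpa [q₁] using hf
  have h2 := IsBigO.finsetProd (s := Finset.univ.erase q₁) (g := fun _ _ ↦ (1 : ℂ))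
    fun q (_ : q ∈ _) ↦ (isBoundedAtImInfty_quotientFunc f q).trans
      (isBigO_of_le _ fun τ ↦ by simp)
  refine (h1.mul h2).congr (fun τ ↦ ?_) fun τ ↦ by simp
  rw [Finset.mul_prod_erase Finset.univ (fun q ↦ SlashInvariantForm.quotientFunc f q τ)
    (Finset.mem_univ q₁), Finset.prod_apply]

lemma norm_apply_eq_zero (f : ModularForm Γ k) {τ : ℍ} (hf : f τ = 0) :
    ModularForm.norm 𝒮ℒ f τ = 0 := by
  rw [ModularForm.coe_norm]
  simpa [Finset.prod_eq_zero_iff, QuotientGroup.exists_mk] using ⟨1, by simpa using hf⟩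

end Norm

section Vanishing

variable {p j n : ℕ} {F : ModularForm (Gamma0 p) (2 * j)} {c : ℕ → ℂ}

lemma eq_zero_of_coeff_eq_zero [Fact p.Prime]
    (hF : ∀ τ : ℍ, HasSum (fun m ↦ c m • Function.Periodic.qParam 1 τ ^ m) (F τ))
    (hc : ∀ m < n, c m = 0)
    (h : 2 * j * (p + 1) < 12 * n ∨ 2 * j * (p + 1) = 12 * n ∧ ∃ τ, F τ = 0) : F = 0 := by
  have hcard := Nat.mul_le_mul_left (2 * j) (card_quotient_Gamma0_le p)
  suffices ModularForm.norm 𝒮ℒ F = 0 by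
    rw [ModularForm.norm_eq_zero_iff] at this
    exact DFunLike.coe_injective this
  refine levelOne_eq_zero_of_isBigO (norm_isBigO F (isBigO_discriminant_pow hF hc)) ?_
  rcases h with h | ⟨h, τ, hτ⟩
  · left
    exact_mod_cast hcard.trans_lt h
  · rcases (hcard.trans h.le).lt_or_eq with h' | h'
    · left
      exact_mod_cast h'
    · right
      exact ⟨by exact_mod_cast h', τ, norm_apply_eq_zero F hτ⟩

/-- The elliptic point `(2 + i) / 5` of order two for `Γ₀(5)`. -/
def ellipticPoint : ℍ := ⟨(2 + Complex.I) / 5, by simp⟩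

lemma apply_ellipticPoint_eq_zero (F : ModularForm (Gamma0 5) (2 * j)) (hj : Odd j) :
    F ellipticPoint = 0 := by
  obtain ⟨γ, h00, h01, h10, h11⟩ : ∃ γ : SL(2, ℤ), γ 0 0 = 2 ∧ γ 0 1 = -1 ∧
      γ 1 0 = 5 ∧ γ 1 1 = -2 :=
    ⟨⟨!![2, -1; 5, -2], by simp [Matrix.det_fin_two_of]⟩, rfl, rfl, rfl, rfl⟩
  have hγ : γ ∈ Gamma0 5 := by
    rw [Gamma0_mem, h10]
    rfl
  have h := SlashInvariantForm.slash_action_eqn_SL'' F hγ ellipticPoint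
  have hden : denom γ ellipticPoint = Complex.I := by
    simp [denom, ellipticPoint, h10, h11]
    ring
  have hfix : γ • ellipticPoint = ellipticPoint := by
    ext
    rw [UpperHalfPlane.coe_specialLinearGroup_apply]
    simp only [algebraMap_int_eq, h00, h01, h10, h11, ellipticPoint, eq_intCast]
    push_cast
    have : (5 * ((2 + Complex.I) / 5) + -2 : ℂ) = Complex.I := by ring
    rw [this, div_eq_iff Complex.I_ne_zero]
    linear_combination -(1 / 5 : ℂ) * Complex.I_sq
  have hI : Complex.I ^ (2 * (j : ℤ)) = -1 := by
    rw [_root_.zpow_mul, zpow_natCast, zpow_two, Complex.I_mul_I, hj.neg_one_pow]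
  rw [hfix, hden, hI] at h
  linear_combination (1 / 2 : ℂ) * h

end Vanishing

/-- The dimension of the space of forms of weight `2 * j` on `Γ₀(p)`, for `p = 2, 3, 5`. -/
def dimGamma0 (p j : ℕ) : ℕ :=
  if p = 2 then j / 2 + 1 else if p = 3 then 2 * j / 3 + 1 else 2 * (j / 2) + 1

lemma exists_hasLead {p j n : ℕ} (hp : p = 2 ∨ p = 3 ∨ p = 5) (hn : n < dimGamma0 p j) :
    ∃ P, IsIntForm p (2 * j) P ∧ HasLead n P := by
  rcases hp with rfl | rfl | rfl
  · exact exists_hasLead_two hn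
  · exact exists_hasLead_three hn
  · exact exists_hasLead_five hn

lemma eq_zero_of_coeff_eq_zero_of_lt_dim {p j : ℕ} (hp : p = 2 ∨ p = 3 ∨ p = 5)
    (F : ModularForm (Gamma0 p) (2 * j))
    (hF : ∀ m < dimGamma0 p j, (qExpansion 1 F).coeff m = 0) : F = 0 := by
  have : Fact p.Prime := ⟨by rcases hp with rfl | rfl | rfl <;> norm_num⟩
  refine eq_zero_of_coeff_eq_zero
    (ModularForm.hasSum_qExpansion F one_pos (one_mem_strictPeriods_Gamma0 p)) hF ?_
  rcases hp with rfl | rfl | rfl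
  · left; simp [dimGamma0]; lia
  · left; simp [dimGamma0]; lia
  · rcases Nat.even_or_odd j with ⟨i, rfl⟩ | hj
    · left; simp [dimGamma0]; lia
    · right
      refine ⟨?_, _, apply_ellipticPoint_eq_zero F hj⟩
      obtain ⟨i, rfl⟩ := hj
      simp [dimGamma0]; lia

lemma exists_isIntForm_congr {p j N : ℕ} (hp : p = 2 ∨ p = 3 ∨ p = 5) (a : ℤ) (c : ℕ → ℤ)
    (hc : ∀ n < N, a ∣ c n) (hN : N ≤ dimGamma0 p j) :
    ∃ Q, IsIntForm p (2 * j) Q ∧ (∀ n, a ∣ Q.coeff n) ∧ ∀ n < N, Q.coeff n = c n := by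
  induction N with
  | zero => exact ⟨0, .zero, by simp, by simp⟩
  | succ N ih =>
    obtain ⟨Q, hQ, hQa, hQc⟩ := ih (fun n hn ↦ hc n (by lia)) (by lia)
    obtain ⟨P, hP, hPX, hP1⟩ := exists_hasLead (j := j) (n := N) hp (by lia)
    rw [PowerSeries.X_pow_dvd_iff] at hPX
    refine ⟨Q + (c N - Q.coeff N) • P, hQ.add (hP.zsmul _), fun n ↦ ?_, fun n hn ↦ ?_⟩
    · rw [map_add, map_zsmul, smul_eq_mul]
      exact dvd_add (hQa n) (((hc N (by lia)).sub (hQa N)).mul_right _)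
    · rw [map_add, map_zsmul, smul_eq_mul]
      rcases (Nat.lt_succ_iff.1 hn).lt_or_eq with h | rfl
      · rw [hPX n h, hQc n h]
        ring
      · rw [hP1]
        ring

/-- The first `N` Fourier coefficients of a form on `Γ₀(p)`. -/
def coeffMap (p : ℕ) (k : ℤ) (N : ℕ) : ModularForm (Gamma0 p) k →ₗ[ℂ] (Fin N → ℂ) where
  toFun F n := (qExpansion 1 F).coeff n
  map_add' F G := by
    ext n
    have := ModularForm.qExpansion_add one_pos (one_mem_strictPeriods_Gamma0 p) F G
    rw [FunLike.coe_add, this]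
    simp
  map_smul' a F := by
    ext n
    have := ModularForm.qExpansion_smul one_pos (one_mem_strictPeriods_Gamma0 p) a F
    rw [show ⇑(a • F) = a • ⇑F from rfl, this]
    simp

lemma finrank_eq_dimGamma0 {p j : ℕ} (hp : p = 2 ∨ p = 3 ∨ p = 5) :
    Module.finrank ℂ (ModularForm (Gamma0 p) (2 * j)) = dimGamma0 p j := by
  have hinj : Function.Injective (coeffMap p (2 * j) (dimGamma0 p j)) := by
    rw [← LinearMap.ker_eq_bot, LinearMap.ker_eq_bot']
    exact fun F hF ↦ eq_zero_of_coeff_eq_zero_of_lt_dim hp F fun m hm ↦ congr_fun hF ⟨m, hm⟩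
  have hsurj : Function.Surjective (coeffMap p (2 * j) (dimGamma0 p j)) := by
    rw [← LinearMap.range_eq_top, eq_top_iff, ← (Pi.basisFun ℂ (Fin (dimGamma0 p j))).span_eq,
      Submodule.span_le]
    rintro _ ⟨i, rfl⟩
    obtain ⟨Q, ⟨F, hF⟩, -, hQ⟩ := exists_isIntForm_congr (j := j) hp 1
      (fun n ↦ if n = i then 1 else 0) (by simp) le_rfl
    refine ⟨F, ?_⟩
    ext m
    simp only [coeffMap, LinearMap.coe_mk, AddHom.coe_mk, hF, PowerSeries.coeff_map, hQ m m.2]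
    simp [Pi.single_apply, Fin.ext_iff]
  rw [(LinearEquiv.ofBijective _ ⟨hinj, hsurj⟩).finrank_eq, Module.finrank_fin_fun]

/-- If the first `d = dim M_k(Γ₀(p))` integer coefficients of `F ∈ M_k(Γ₀(p))` are
divisible by `pˢ`, then all its coefficients are. -/
theorem stmt_13 (p : ℕ) (hp : p ∈ ({2, 3, 5} : Set ℕ)) (k : ℤ) (hk : Even k)
    (hk0 : 0 ≤ k) (d : ℕ) (hd : d = Module.finrank ℂ (ModularForm (Gamma0 p) k))
    (F : ModularForm (Gamma0 p) k) (c : ℕ → ℤ)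
    (hF : HasHoloExpansion (⇑F) (fun n => (c n : ℂ)))
    (s : ℕ) (hdiv : ∀ n : ℕ, n < d → (p : ℤ) ^ s ∣ c n) :
    ∀ n : ℕ, (p : ℤ) ^ s ∣ c n := by
  have hp' : p = 2 ∨ p = 3 ∨ p = 5 := by simpa using hp
  obtain ⟨j, rfl⟩ : ∃ j : ℕ, k = 2 * j := by
    obtain ⟨i, rfl⟩ := hk
    exact ⟨i.toNat, by lia⟩
  rw [finrank_eq_dimGamma0 hp'] at hd
  subst hd
  obtain ⟨Q, ⟨G, hG⟩, hQ, hQc⟩ := exists_isIntForm_congr hp' _ c hdiv le_rfl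
  have hc (n : ℕ) : (c n : ℂ) = (qExpansion 1 F).coeff n := by
    refine ModularFormClass.qExpansion_coeff_unique (c := fun n ↦ (c n : ℂ)) one_pos
      (one_mem_strictPeriods_Gamma0 p) (fun τ ↦ ?_) n
    simpa [Function.Periodic.qParam, qexp] using hF τ
  have hsub : F - G = 0 := by
    refine eq_zero_of_coeff_eq_zero_of_lt_dim hp' _ fun m hm ↦ ?_
    have := ModularForm.qExpansion_sub one_pos (one_mem_strictPeriods_Gamma0 p) F G
    rw [FunLike.coe_sub, this, map_sub, ← hc, hG, PowerSeries.coeff_map, hQc m hm]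
    simp
  intro n
  have : (c n : ℂ) = Q.coeff n := by
    rw [hc, sub_eq_zero.1 hsub, hG, PowerSeries.coeff_map]
    simp
  rw [Int.cast_injective this]
  exact hQ n
end
end

section
/- Let p ∈ {2,3,5}, k < 0 even, and f ∈ M_k^!(Γ_0(p)) holomorphic at the cusp 0. Then ord_∞(f) ≤ k(v_2(p)/4 + v_3(p)/3), where v_2(2)=1, v_2(3)=0, v_2(5)=2, v_3(2)=0, v_3(3)=1, v_3(5)=0. If equality holds, f is nonvanishing on the upper half plane and at 0. -/
open UpperHalfPlane Complex CongruenceSubgroup MatrixGroups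
open scoped ModularForm Real MatrixGroups Manifold

noncomputable section

/-- `f` has the expansion `τ^{-k} f(-1/τ) = ∑ c n e^{2πinτ/p}` at the cusp `0` of `Γ₀(p)`,
with only finitely many negative terms. -/
def HasExpansionAtZero (p : ℕ) (k : ℤ) (f : UpperHalfPlane → ℂ) (c : ℤ → ℂ) : Prop :=
  (∃ N : ℤ, ∀ n : ℤ, n < N → c n = 0) ∧
    ∀ τ : UpperHalfPlane,
      HasSum (fun n : ℤ => c n * Complex.exp (2 * π * Complex.I * n * τ / p))
        ((τ : ℂ) ^ (-k) * f (neginv τ))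

/-- The quantity `v₂(p)` of the valence formula, for `p ∈ {2,3,5}`. -/
def paperV2 (p : ℕ) : ℚ := if p = 2 then 1 else if p = 5 then 2 else 0

/-- The quantity `v₃(p)` of the valence formula, for `p ∈ {2,3,5}`. -/
def paperV3 (p : ℕ) : ℚ := if p = 3 then 1 else 0

open Filter Topology

/-- The leading coefficient of a `q`-expansion is the limit of `F(τ) q^{-n₀}` at `i∞`. -/
lemma tendsto_mul_exp_atImInfty_of_hasSum {h : ℝ} (hpos : 0 < h) {F : UpperHalfPlane → ℂ}
    {c : ℤ → ℂ} {n₀ : ℤ} (hc : ∀ n < n₀, c n = 0)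
    (hs : ∀ τ : UpperHalfPlane,
      HasSum (fun n : ℤ => c n * Complex.exp (2 * π * Complex.I * n * τ / h)) (F τ)) :
    Tendsto (fun τ : UpperHalfPlane => F τ * Complex.exp (-(2 * π * Complex.I * n₀ * τ / h)))
      atImInfty (𝓝 (c n₀)) := by
  let t : UpperHalfPlane → ℤ → ℂ := fun τ n =>
    c n * Complex.exp (2 * π * Complex.I * (n - n₀ : ℤ) * τ / h)
  have ht (τ : UpperHalfPlane) :
      HasSum (t τ) (F τ * Complex.exp (-(2 * π * Complex.I * n₀ * τ / h))) := by
    convert! (hs τ).mul_right (Complex.exp (-(2 * π * Complex.I * n₀ * τ / h))) using 2 with n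
    rw [mul_assoc, ← Complex.exp_add]
    simp only [t]
    congr 2
    push_cast
    ring
  have hnorm (τ : UpperHalfPlane) (n : ℤ) :
      ‖t τ n‖ = ‖c n‖ * Real.exp (-(2 * π * (n - n₀ : ℤ) / h) * τ.im) := by
    simp only [t, norm_mul, Complex.norm_exp]
    congr 2
    rw [show 2 * π * Complex.I * (n - n₀ : ℤ) * τ / h
      = ((2 * π * (n - n₀ : ℤ) / h : ℝ) : ℂ) * (Complex.I * τ) by push_cast; ring,
      Complex.re_ofReal_mul]
    simp
  have key : Tendsto (fun τ => ∑' n, t τ n) atImInfty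
      (𝓝 (∑' n, if n = n₀ then c n₀ else 0)) := by
    refine tendsto_tsum_of_dominated_convergence (bound := fun n => ‖t UpperHalfPlane.I n‖)
      (ht _).summable.norm (fun n => ?_) ?_
    · rcases lt_trichotomy n n₀ with hn | rfl | hn
      · simp [t, hc n hn, hn.ne]
      · simp [t]
      · rw [if_neg hn.ne', tendsto_zero_iff_norm_tendsto_zero]
        simp only [hnorm]
        rw [← mul_zero ‖c n‖]
        refine Tendsto.const_mul _ (Real.tendsto_exp_atBot.comp ?_)
        refine Tendsto.const_mul_atTop_of_neg ?_ (tendsto_comap (f := UpperHalfPlane.im))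
        have : (0 : ℝ) < (n - n₀ : ℤ) := by exact_mod_cast sub_pos.2 hn
        have := Real.pi_pos
        simp only [Left.neg_neg_iff]
        positivity
    · have : ∀ᶠ τ : UpperHalfPlane in atImInfty, 1 ≤ τ.im :=
        (tendsto_comap (f := UpperHalfPlane.im)).eventually (eventually_ge_atTop 1)
      filter_upwards [this] with τ hτ n
      rcases lt_or_ge n n₀ with hn | hn
      · simp [t, hc n hn]
      · rw [hnorm, hnorm]
        refine mul_le_mul_of_nonneg_left (Real.exp_le_exp.2 ?_) (norm_nonneg _)
        refine mul_le_mul_of_nonpos_left (by simpa using hτ) ?_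
        have : (0 : ℝ) ≤ (n - n₀ : ℤ) := by exact_mod_cast sub_nonneg.2 hn
        have := Real.pi_pos
        simp only [Left.neg_nonpos_iff]
        positivity
  rw [tsum_ite_eq] at key
  exact key.congr fun τ => (ht τ).tsum_eq

lemma discriminant_smul (γ : SL(2, ℤ)) (τ : UpperHalfPlane) :
    ModularForm.discriminant (γ • τ) = denom γ τ ^ 12 * ModularForm.discriminant τ := by
  have h := congrFun (SlashInvariantForm.slash_action_generators_SL2Z
    ModularForm.discriminant_S_invariant ModularForm.discriminant_T_invariant γ) τ
  rw [ModularForm.SL_slash_apply, zpow_neg, zpow_ofNat] at h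
  rw [← h]
  field_simp [denom_ne_zero]

lemma discriminant_neginv (τ : UpperHalfPlane) :
    ModularForm.discriminant (neginv τ) = (τ : ℂ) ^ 12 * ModularForm.discriminant τ := by
  rw [neginv, ← UpperHalfPlane.modular_S_smul, discriminant_smul, ModularGroup.denom_S]

lemma discriminant_rscale_smul {p : ℕ} (hp : 0 < (p : ℝ)) {γ : SL(2, ℤ)} (hγ : γ ∈ Gamma0 p)
    (τ : UpperHalfPlane) :
    ModularForm.discriminant (rscale p hp (γ • τ)) =
      denom γ τ ^ 12 * ModularForm.discriminant (rscale p hp τ) := by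
  obtain ⟨c, hc⟩ := (ZMod.intCast_zmod_eq_zero_iff_dvd _ p).1 (Gamma0_mem.1 hγ)
  have hdet := γ.det_coe
  rw [Matrix.det_fin_two, hc] at hdet
  let γ' : SL(2, ℤ) := ⟨!![γ 0 0, p * γ 0 1; c, γ 1 1], by
    rw [Matrix.det_fin_two_of]; linear_combination hdet⟩
  have hden : denom γ' (rscale p hp τ) = denom γ τ := by
    simp only [ModularGroup.denom_apply, hc]
    simp [γ', rscale]
    ring
  have hsmul : rscale p hp (γ • τ) = γ' • rscale p hp τ := by
    ext
    rw [coe_specialLinearGroup_apply]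
    simp only [rscale, coe_specialLinearGroup_apply, hc]
    simp [γ']
    field_simp
  rw [hsmul, discriminant_smul, hden]

lemma tendsto_rscale_atImInfty {a : ℝ} (ha : 0 < a) :
    Tendsto (rscale a ha) atImInfty atImInfty := by
  rw [atImInfty, tendsto_comap_iff]
  refine Tendsto.congr (fun τ => ?_) ((tendsto_comap (f := UpperHalfPlane.im)).const_mul_atTop ha)
  simp [rscale, ← coe_im]

lemma tendsto_discriminant_mul_exp :
    Tendsto (fun τ : UpperHalfPlane => ModularForm.discriminant τ *
      Complex.exp (-(2 * π * Complex.I * τ))) atImInfty (𝓝 1) := by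
  refine ModularForm.tendsto_atImInfty_tprod_one_sub_eta_q_pow.congr fun τ => ?_
  rw [ModularForm.discriminant_eq_q_prod, mul_right_comm, Function.Periodic.qParam,
    ← Complex.exp_add]
  simp

lemma mdifferentiable_discriminant_rscale {a : ℝ} (ha : 0 < a) :
    MDifferentiable 𝓘(ℂ) 𝓘(ℂ) fun τ => ModularForm.discriminant (rscale a ha τ) := by
  rw [UpperHalfPlane.mdifferentiable_iff]
  have hd : DifferentiableOn ℂ (fun z : ℂ => ModularForm.eta (a * z) ^ 24)
      upperHalfPlaneSet := fun z hz => by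
    have : DifferentiableAt ℂ ModularForm.eta (a * z) :=
      ModularForm.differentiableAt_eta_of_mem_upperHalfPlaneSet
        (by simpa [upperHalfPlaneSet, Complex.mul_im] using mul_pos ha hz)
    exact ((this.comp z (by fun_prop)).pow 24).differentiableWithinAt
  refine hd.congr fun z hz => ?_
  simp [ModularForm.discriminant, ofComplex_apply_of_im_pos hz, rscale]

/-- The quotient `Δ(pτ)^p / Δ(τ)`, of weight `12(p-1)` on `Γ₀(p)`, whose only zero is at `∞`. -/
def discQuot (p : ℕ) (hp : 0 < (p : ℝ)) (τ : UpperHalfPlane) : ℂ :=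
  ModularForm.discriminant (rscale p hp τ) ^ p / ModularForm.discriminant τ

lemma discQuot_ne_zero {p : ℕ} (hp : 0 < (p : ℝ)) (τ : UpperHalfPlane) : discQuot p hp τ ≠ 0 :=
  div_ne_zero (pow_ne_zero _ (ModularForm.discriminant_ne_zero _))
    (ModularForm.discriminant_ne_zero _)

lemma mdifferentiable_discQuot {p : ℕ} (hp : 0 < (p : ℝ)) :
    MDifferentiable 𝓘(ℂ) 𝓘(ℂ) (discQuot p hp) := by
  have h1 := UpperHalfPlane.mdifferentiable_iff.1 (mdifferentiable_discriminant_rscale hp)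
  have h2 := UpperHalfPlane.mdifferentiable_iff.1 CuspForm.discriminant.holo'
  rw [UpperHalfPlane.mdifferentiable_iff]
  exact (h1.pow p).div h2 fun z _ => ModularForm.discriminant_ne_zero _

lemma discQuot_smul {p : ℕ} (hp : 0 < (p : ℝ)) {γ : SL(2, ℤ)} (hγ : γ ∈ Gamma0 p)
    (τ : UpperHalfPlane) :
    discQuot p hp (γ • τ) = denom γ τ ^ (12 * (p - 1 : ℤ)) * discQuot p hp τ := by
  have hd : denom γ τ ≠ 0 := denom_ne_zero γ τ
  rw [discQuot, discriminant_rscale_smul hp hγ, discriminant_smul, discQuot, mul_sub,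
    zpow_sub₀ hd, mul_pow, ← pow_mul]
  have : (12 : ℤ) * p = (12 * p : ℕ) := by push_cast; rfl
  rw [this, zpow_natCast]
  field_simp
  norm_cast

lemma tendsto_discQuot {p : ℕ} (hp : 0 < (p : ℝ)) :
    Tendsto (fun τ : UpperHalfPlane => discQuot p hp τ *
      Complex.exp (-(2 * π * Complex.I * (p ^ 2 - 1) * τ))) atImInfty (𝓝 1) := by
  have h := ((tendsto_discriminant_mul_exp.comp (tendsto_rscale_atImInfty hp)).pow p).div
    tendsto_discriminant_mul_exp one_ne_zero
  simp only [one_pow, div_one] at h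
  refine h.congr fun τ => ?_
  have hpc : ((rscale p hp τ : UpperHalfPlane) : ℂ) = p * τ := by simp [rscale]
  simp only [Pi.div_apply, Function.comp_apply, discQuot, hpc, mul_pow,
    mul_div_mul_comm, ← Complex.exp_nat_mul, ← Complex.exp_sub]
  congr 2
  ring

lemma discQuot_neginv {p : ℕ} (hp : 0 < (p : ℝ)) (τ : UpperHalfPlane) :
    discQuot p hp (neginv τ) = (τ : ℂ) ^ (12 * (p - 1 : ℤ)) * ((p : ℂ) ^ (12 * p))⁻¹ *
      (ModularForm.discriminant (rscale (p : ℝ)⁻¹ (inv_pos.2 hp) τ) ^ p /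
        ModularForm.discriminant τ) := by
  have hp0 : (p : ℂ) ≠ 0 := by exact_mod_cast hp.ne'
  have hτ := τ.ne_zero
  have h1 : rscale p hp (neginv τ) = neginv (rscale (p : ℝ)⁻¹ (inv_pos.2 hp) τ) := by
    ext
    simp [rscale, neginv, mul_comm]
  have h2 : ((rscale (p : ℝ)⁻¹ (inv_pos.2 hp) τ : UpperHalfPlane) : ℂ) = (p : ℂ)⁻¹ * τ := by
    simp [rscale]
  have h3 : (τ : ℂ) ^ (12 * (p - 1 : ℤ)) = (τ : ℂ) ^ (12 * p) / (τ : ℂ) ^ 12 := by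
    rw [mul_sub, zpow_sub₀ hτ]
    norm_cast
  rw [discQuot, h1, discriminant_neginv, discriminant_neginv, h2, h3, mul_pow, ← pow_mul, mul_pow,
    inv_pow]
  field_simp

lemma tendsto_discriminant_rscale_inv_pow_div {p : ℕ} (hp : 0 < (p : ℝ)) :
    Tendsto (fun τ => ModularForm.discriminant (rscale (p : ℝ)⁻¹ (inv_pos.2 hp) τ) ^ p /
        ModularForm.discriminant τ) atImInfty (𝓝 1) := by
  have h := ((tendsto_discriminant_mul_exp.comp
    (tendsto_rscale_atImInfty (inv_pos.2 hp))).pow p).div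
    tendsto_discriminant_mul_exp one_ne_zero
  simp only [one_pow, div_one] at h
  refine h.congr fun τ => ?_
  have hpc : ((rscale (p : ℝ)⁻¹ (inv_pos.2 hp) τ : UpperHalfPlane) : ℂ) = (p : ℂ)⁻¹ * τ := by
    simp [rscale]
  have hp0 : (p : ℂ) ≠ 0 := by exact_mod_cast hp.ne'
  simp only [Pi.div_apply, Function.comp_apply, hpc, mul_pow,
    mul_div_mul_comm, ← Complex.exp_nat_mul, ← Complex.exp_sub]
  rw [show (p : ℂ) * -(2 * π * Complex.I * ((p : ℂ)⁻¹ * τ)) - -(2 * π * Complex.I * τ) = 0 by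
    field_simp; ring]
  simp

lemma exists_mem_Gamma0_mul_S_mul_T_zpow {p : ℕ} [Fact p.Prime] {γ : SL(2, ℤ)}
    (hγ : γ ∉ Gamma0 p) :
    ∃ γ' ∈ Gamma0 p, ∃ j : ℤ, γ = γ' * ModularGroup.S * ModularGroup.T ^ j := by
  rw [Gamma0_mem] at hγ
  obtain ⟨j, hj⟩ := ZMod.intCast_surjective ((γ 1 1 : ZMod p) / (γ 1 0 : ZMod p))
  refine ⟨γ * ModularGroup.T ^ (-j) * ModularGroup.S⁻¹, ?_, j, by simp [mul_assoc]⟩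
  have : (γ * ModularGroup.T ^ (-j) * ModularGroup.S⁻¹) 1 0 = j * γ 1 0 - γ 1 1 := by
    simp only [Matrix.SpecialLinearGroup.coe_mul, ModularGroup.coe_T_zpow,
      Matrix.SpecialLinearGroup.coe_inv, ModularGroup.coe_S]
    simp [Matrix.mul_apply, Fin.sum_univ_two, Matrix.adjugate_fin_two]
    ring
  rw [Gamma0_mem, this]
  push_cast
  rw [hj, div_mul_cancel₀ _ hγ, sub_self]

/-- A holomorphic `Γ₀(p)`-invariant function with finite limits at both cusps is constant. -/
lemma eq_const_of_Gamma0_invariant {p : ℕ} [Fact p.Prime] {G : UpperHalfPlane → ℂ}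
    (hG : MDifferentiable 𝓘(ℂ) 𝓘(ℂ) G) (hinv : ∀ γ ∈ Gamma0 p, ∀ τ, G (γ • τ) = G τ) {a b : ℂ}
    (ha : Tendsto G atImInfty (𝓝 a)) (hb : Tendsto (fun τ => G (neginv τ)) atImInfty (𝓝 b)) :
    (∀ τ, G τ = a) ∧ b = a := by
  have hslash (γ : SL(2, ℤ)) : G ∣[(0 : ℤ)] γ = fun τ => G (γ • τ) := by
    ext τ
    simp [ModularForm.SL_slash_apply]
  have hbdd (γ : SL(2, ℤ)) : IsBoundedAtImInfty (G ∣[(0 : ℤ)] γ) := by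
    rw [hslash]
    by_cases hγ : γ ∈ Gamma0 p
    · simp_rw [hinv γ hγ]
      exact ha.isBigO_one ℝ
    · obtain ⟨γ', hγ', j, rfl⟩ := exists_mem_Gamma0_mul_S_mul_T_zpow hγ
      have hT : Tendsto (fun τ : UpperHalfPlane => ModularGroup.T ^ j • τ) atImInfty atImInfty := by
        refine tendsto_comap_iff.2 (tendsto_comap.congr fun τ => ?_)
        rw [Function.comp_apply, modular_T_zpow_smul, vadd_im]
      refine ((hb.comp hT).congr fun τ => ?_).isBigO_one ℝ
      rw [mul_smul, mul_smul, hinv γ' hγ', UpperHalfPlane.modular_S_smul]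
      rfl
  let F : ModularForm (Gamma0 p : Subgroup (GL (Fin 2) ℝ)) 0 :=
    { toFun := G
      slash_action_eq' := by
        rintro _ ⟨γ, hγ, rfl⟩
        exact (hslash γ).trans (funext (hinv γ hγ))
      holo' := hG
      bdd_at_cusps' := fun hc => by
        rw [Subgroup.IsArithmetic.isCusp_iff_isCusp_SL2Z] at hc
        rw [OnePoint.isBoundedAt_iff_forall_SL2Z hc]
        exact fun γ _ => hbdd γ }
  obtain ⟨c, hc⟩ := ModularForm.eq_const_of_weight_zero F
  obtain rfl : G = Function.const _ c := hc
  obtain rfl := tendsto_nhds_unique ha tendsto_const_nhds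
  exact ⟨fun _ => rfl, tendsto_nhds_unique hb tendsto_const_nhds⟩

/-- If `f` is holomorphic at `0` and `n` is at most its order at `∞`, then `f ^ m` times a power of
`discQuot p` is constant, where `m = 12 (p - 1)`. -/
lemma WhmForm.pow_mul_discQuot_pow_eq_const {p : ℕ} [hprime : Fact p.Prime] (hp : 0 < (p : ℝ))
    {k : ℤ} (f : WhmForm (Gamma0 p) k) {c₀ : ℤ → ℂ} (h0 : HasExpansionAtZero p k f.toFun c₀)
    (hhol0 : ∀ n : ℤ, n < 0 → c₀ n = 0) {n : ℤ} (hn : ∀ i < n, f.coeff i = 0) {m K e : ℕ}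
    (hm : (m : ℤ) = 12 * (p - 1)) (hK : (K : ℤ) = -k) (he : (e : ℤ) = m * n + K * (p ^ 2 - 1)) :
    (∀ τ, f.toFun τ ^ m * discQuot p hp τ ^ K = f.coeff n ^ m * 0 ^ e) ∧
      c₀ 0 ^ m * ((p : ℂ) ^ (12 * p))⁻¹ ^ K = f.coeff n ^ m * 0 ^ e := by
  refine eq_const_of_Gamma0_invariant (p := p) ?_ (fun γ hγ τ => ?_) ?_ ?_
  · have h1 := UpperHalfPlane.mdifferentiable_iff.1 f.holo
    have h2 := UpperHalfPlane.mdifferentiable_iff.1 (mdifferentiable_discQuot hp)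
    rw [UpperHalfPlane.mdifferentiable_iff]
    exact (h1.pow m).mul (h2.pow K)
  · have h := congrFun (f.slash_eq γ hγ) τ
    have hd : denom γ τ ≠ 0 := denom_ne_zero γ τ
    rw [ModularForm.SL_slash_apply, ← hK, zpow_natCast] at h
    rw [discQuot_smul hp hγ, ← hm, zpow_natCast, ← h]
    ring
  · have h1 := tendsto_mul_exp_atImInfty_of_hasSum one_pos hn (F := f.toFun) fun τ => by
      convert! f.expansion.2 τ using 3 with i
      rw [qexp, ← Complex.exp_int_mul]
      congr 1
      simp
      ring
    have h2 := tendsto_discQuot hp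
    have h3 := qParam_tendsto_atImInfty one_pos
    have h := ((h1.pow m).mul (h2.pow K)).mul (h3.pow e)
    simp only [one_pow, mul_one] at h
    refine h.congr fun τ => ?_
    rw [Function.Periodic.qParam, mul_pow, mul_pow, mul_mul_mul_comm, mul_assoc,
      ← Complex.exp_nat_mul, ← Complex.exp_nat_mul, ← Complex.exp_nat_mul, ← Complex.exp_add,
      ← Complex.exp_add]
    have he' : (e : ℂ) = m * n + K * (p ^ 2 - 1) := by exact_mod_cast he
    rw [he']
    convert mul_one _
    rw [← Complex.exp_zero]
    congr 1
    push_cast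
    ring
  · have h1 := tendsto_mul_exp_atImInfty_of_hasSum hp hhol0
      (F := fun τ => (τ : ℂ) ^ K * f.toFun (neginv τ)) (by simpa [← hK] using h0.2)
    have h2 := tendsto_discriminant_rscale_inv_pow_div hp
    have h := ((h1.pow m).mul_const (((p : ℂ) ^ (12 * p))⁻¹ ^ K)).mul (h2.pow K)
    simp only [one_pow, mul_one] at h
    refine h.congr fun τ => ?_
    rw [discQuot_neginv, ← hm]
    simp only [zpow_natCast, Int.cast_zero, mul_zero, zero_mul, zero_div, neg_zero,
      Complex.exp_zero, mul_one]
    ring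

/-- For `f ∈ M_k^!(Γ₀(p))` of negative even weight, holomorphic at the cusp `0`,
`ord_∞ f ≤ k (v₂(p)/4 + v₃(p)/3)`; in case of equality, `f` is nonvanishing on the
upper half plane and at `0`. -/
theorem stmt_14 (p : ℕ) (hp : p ∈ ({2, 3, 5} : Set ℕ)) (k : ℤ) (hk : Even k)
    (hkneg : k < 0) (f : WhmForm (Gamma0 p) k) (hf : f.toFun ≠ 0)
    (c0 : ℤ → ℂ) (h0 : HasExpansionAtZero p k f.toFun c0)
    (hhol0 : ∀ n : ℤ, n < 0 → c0 n = 0) :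
    (∃ n : ℤ, f.coeff n ≠ 0 ∧ (n : ℚ) ≤ k * (paperV2 p / 4 + paperV3 p / 3)) ∧
    (∀ n₀ : ℤ, (n₀ : ℚ) = k * (paperV2 p / 4 + paperV3 p / 3) → f.coeff n₀ ≠ 0 →
      (∀ n : ℤ, n < n₀ → f.coeff n = 0) →
      (∀ τ : UpperHalfPlane, f.toFun τ ≠ 0) ∧ c0 0 ≠ 0) := by
  have hprime : p.Prime := by rcases hp with rfl | rfl | rfl <;> norm_num
  have := Fact.mk hprime
  have hp0 : 0 < (p : ℝ) := by exact_mod_cast hprime.pos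
  obtain ⟨K, hK⟩ : ∃ K : ℕ, (K : ℤ) = -k := ⟨k.natAbs, by omega⟩
  obtain ⟨m, hm⟩ : ∃ m : ℕ, (m : ℤ) = 12 * (p - 1) :=
    ⟨12 * (p - 1), by push_cast [Nat.cast_sub hprime.one_le]; ring⟩
  have hm0 : m ≠ 0 := by have := hprime.two_le; omega
  have hbound : (m : ℚ) * (k * (paperV2 p / 4 + paperV3 p / 3)) = -(K * (p ^ 2 - 1)) := by
    have hK' : (K : ℚ) = -k := by exact_mod_cast hK
    have hm' : (m : ℚ) = 12 * (p - 1) := by exact_mod_cast hm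
    rw [hK', hm']
    rcases hp with rfl | rfl | rfl <;> norm_num [paperV2, paperV3] <;> ring
  generalize k * (paperV2 p / 4 + paperV3 p / 3) = B at hbound ⊢
  have hmpos : (0 : ℚ) < m := by exact_mod_cast Nat.pos_of_ne_zero hm0
  refine ⟨?_, fun n₀ hn₀ hcoeff hlt => ?_⟩
  · by_contra! hcon
    have hn (i : ℤ) (hi : i < ⌊B⌋ + 1) : f.coeff i = 0 := by
      by_contra h
      exact (hcon i h).not_ge (Int.le_floor.1 (Int.lt_add_one_iff.1 hi))
    have he : (0 : ℤ) < m * (⌊B⌋ + 1) + K * (p ^ 2 - 1) := by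
      have := mul_lt_mul_of_pos_left (Int.lt_floor_add_one B) hmpos
      have : (0 : ℚ) < m * (⌊B⌋ + 1) + K * (p ^ 2 - 1) := by linarith
      exact_mod_cast this
    obtain ⟨e, he'⟩ := Int.eq_ofNat_of_zero_le he.le
    have he0 : e ≠ 0 := by rintro rfl; exact he.ne' he'
    have hconst := (f.pow_mul_discQuot_pow_eq_const hp0 h0 hhol0 hn hm hK he'.symm).1
    refine hf (funext fun τ => ?_)
    simpa [he0, hm0, discQuot_ne_zero] using hconst τ
  · have he : ((0 : ℕ) : ℤ) = m * n₀ + K * (p ^ 2 - 1) := by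
      have : (0 : ℚ) = m * n₀ + K * (p ^ 2 - 1) := by rw [hn₀, hbound]; ring
      exact_mod_cast this
    obtain ⟨h, h'⟩ := f.pow_mul_discQuot_pow_eq_const hp0 h0 hhol0 hlt hm hK he
    have hne : f.coeff n₀ ^ m * 0 ^ 0 ≠ 0 := by simpa using fun h => absurd h hcoeff
    refine ⟨fun τ hτ => hne ?_, fun hc => hne ?_⟩
    · rw [← h τ, hτ, zero_pow hm0, zero_mul]
    · rw [← h', hc, zero_pow hm0, zero_mul]
end
end

section
/- Let p ∈ {2,3,5,7,13}, k ∈ {4,6,8,10,14}, λ = 24/(p-1), m > 0, s > 0. Then g(τ) = f_{k, m p^s}(τ) - f_{k, m p^{s-1}}(pτ) is congruent modulo p^{λ/2} to a holomorphic modular form F ∈ M_k(Γ_0(p)) with integer coefficients vanishing at ∞. -/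
open UpperHalfPlane Complex CongruenceSubgroup MatrixGroups
open scoped ModularForm Real MatrixGroups Manifold

noncomputable section

open scoped PowerSeries

/-- The power series `P` converges at `q`, with value `a`. -/
def EvalAt {R : Type*} [CommRing R] [Algebra R ℂ] (P : R⟦X⟧) (q a : ℂ) : Prop :=
  HasSum (fun n => algebraMap R ℂ (PowerSeries.coeff n P) * q ^ n) a

namespace EvalAt

variable {R : Type*} [CommRing R] [Algebra R ℂ] {P Q : R⟦X⟧} {q a b : ℂ}

lemma add (hP : EvalAt P q a) (hQ : EvalAt Q q b) : EvalAt (P + Q) q (a + b) := by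
  simpa [EvalAt, add_mul] using HasSum.add hP hQ

lemma sub (hP : EvalAt P q a) (hQ : EvalAt Q q b) : EvalAt (P - Q) q (a - b) := by
  simpa [EvalAt, sub_mul] using HasSum.sub hP hQ

lemma mul (hP : EvalAt P q a) (hQ : EvalAt Q q b) : EvalAt (P * Q) q (a * b) := by
  have := summable_norm_sum_mul_antidiagonal_of_summable_norm hP.summable.norm hQ.summable.norm
  have h2 := tsum_mul_tsum_eq_tsum_sum_antidiagonal_of_summable_norm
    hP.summable.norm hQ.summable.norm
  rw [hP.tsum_eq, hQ.tsum_eq] at h2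
  rw [h2]
  refine HasSum.congr_fun (f := _) this.of_norm.hasSum ?_
  intro n
  rw [PowerSeries.coeff_mul, map_sum, Finset.sum_mul]
  refine Finset.sum_congr rfl fun x hx => ?_
  rw [← Finset.HasAntidiagonal.mem_antidiagonal.mp hx, pow_add, map_mul]
  ring

lemma C (r : R) : EvalAt (PowerSeries.C r) q (algebraMap R ℂ r) := by
  have : ∀ n ≠ 0, algebraMap R ℂ (PowerSeries.coeff n (PowerSeries.C r)) * q ^ n = 0 := by
    intro n hn
    simp [PowerSeries.coeff_C, hn]
  simpa [EvalAt] using hasSum_single 0 this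

lemma one : EvalAt (1 : R⟦X⟧) q 1 := by
  simpa using C (q := q) (1 : R)

lemma X : EvalAt (PowerSeries.X : R⟦X⟧) q q := by
  have : ∀ n ≠ 1, algebraMap R ℂ (PowerSeries.coeff n (PowerSeries.X : R⟦X⟧)) * q ^ n = 0 := by
    intro n hn
    simp [PowerSeries.coeff_X, hn]
  simpa [EvalAt] using hasSum_single 1 this

lemma pow (hP : EvalAt P q a) (n : ℕ) : EvalAt (P ^ n) q (a ^ n) := by
  induction n with
  | zero => simpa using one
  | succ n ih => simpa [pow_succ] using ih.mul hP

lemma aeval {P : ℤ⟦X⟧} (hP : EvalAt P q a) (c : Polynomial ℤ) :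
    EvalAt (Polynomial.aeval P c) q (Polynomial.aeval a c) := by
  induction c using Polynomial.induction_on' with
  | add p r hp hr => simpa using hp.add hr
  | monomial n r =>
    have := (C (q := q) r).mul (hP.pow n)
    simpa [Polynomial.aeval_monomial] using this

lemma expand {p : ℕ} (hp : p ≠ 0) (hP : EvalAt P (q ^ p) a) :
    EvalAt (PowerSeries.expand p hp P) q a := by
  have hinj : Function.Injective (fun n : ℕ => p * n) := fun _ _ h =>
    Nat.eq_of_mul_eq_mul_left (Nat.pos_of_ne_zero hp) h
  refine (hinj.hasSum_iff ?_).mp ?_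
  · intro n hn
    rw [PowerSeries.coeff_expand_of_not_dvd, map_zero, zero_mul]
    rintro ⟨k, rfl⟩
    exact hn ⟨k, rfl⟩
  · simpa [Function.comp_def, pow_mul, EvalAt] using hP

/-- Division by the variable. -/
lemma exists_of_X_mul (hq : q ≠ 0) (hP : EvalAt (PowerSeries.X * P) q (q * a)) :
    EvalAt P q a := by
  unfold EvalAt at hP
  rw [← hasSum_nat_add_iff' 1] at hP
  have := hP.mul_left q⁻¹
  simp only [PowerSeries.coeff_succ_X_mul, Finset.range_one, Finset.sum_singleton,
    PowerSeries.coeff_zero_X_mul, map_zero, zero_mul, sub_zero, inv_mul_cancel_left₀ hq] at this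
  refine this.congr_fun fun n => ?_
  field_simp
  ring

lemma map (hP : EvalAt P q a) : EvalAt (P.map (algebraMap R ℂ)) q a := by
  simpa [EvalAt] using hP

end EvalAt

lemma EvalAt.hasFPowerSeriesOnBall {P : ℂ⟦X⟧} {A : ℂ → ℂ}
    (hP : ∀ q : ℂ, ‖q‖ < 1 → EvalAt P q (A q)) :
    HasFPowerSeriesOnBall A (.ofScalars ℂ fun n => PowerSeries.coeff n P) 0 1 := by
  constructor
  · refine le_of_forall_lt_imp_le_of_dense fun r hr ↦ ?_
    lift r to NNReal using hr.ne_top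
    apply FormalMultilinearSeries.le_radius_of_summable
    simpa [mul_comm] using (hP r (by simpa using hr)).summable.norm
  · simp
  · intro y hy
    rw [← ENNReal.coe_one, Metric.eball_coe, NNReal.coe_one, mem_ball_zero_iff] at hy
    simpa [mul_comm, EvalAt] using hP y hy

lemma EvalAt.unique {P Q : ℂ⟦X⟧} {A : ℂ → ℂ}
    (hP : ∀ q : ℂ, ‖q‖ < 1 → EvalAt P q (A q)) (hQ : ∀ q : ℂ, ‖q‖ < 1 → EvalAt Q q (A q)) :
    P = Q := by
  have h := (EvalAt.hasFPowerSeriesOnBall hP).hasFPowerSeriesAt.eq_formalMultilinearSeries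
    (EvalAt.hasFPowerSeriesOnBall hQ).hasFPowerSeriesAt
  ext n
  simpa using congr_arg (FormalMultilinearSeries.coeff · n) h

lemma evalAt_of_differentiableOn {A : ℂ → ℂ} (hA : DifferentiableOn ℂ A (Metric.ball 0 1))
    {q : ℂ} (hq : ‖q‖ < 1) :
    EvalAt (PowerSeries.mk fun n => (n.factorial : ℂ)⁻¹ * iteratedDeriv n A 0) q (A q) := by
  have := Complex.hasSum_taylorSeries_on_ball hA (z := q) (by simpa using hq)
  simpa [EvalAt, mul_comm, mul_left_comm, mul_assoc] using this

lemma iteratedDeriv_tendsto {F : ℕ → ℂ → ℂ} {f : ℂ → ℂ} {U : Set ℂ} (hU : IsOpen U)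
    (hF : ∀ N, DifferentiableOn ℂ (F N) U)
    (h : TendstoLocallyUniformlyOn F f Filter.atTop U) (n : ℕ) :
    TendstoLocallyUniformlyOn (fun N => iteratedDeriv n (F N)) (iteratedDeriv n f)
      Filter.atTop U := by
  induction n with
  | zero => simpa using h
  | succ n ih =>
    simp only [iteratedDeriv_succ]
    refine ih.deriv (Filter.Eventually.of_forall fun N => ?_) hU
    rw [iteratedDeriv_eq_iterate]
    exact (((hF N).analyticOnNhd hU).iterated_deriv n).differentiableOn

lemma exists_evalAt_int {F : ℕ → ℂ → ℂ} {f : ℂ → ℂ} {P : ℕ → ℤ⟦X⟧}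
    (hF : ∀ N, DifferentiableOn ℂ (F N) (Metric.ball 0 1))
    (hP : ∀ N q, ‖q‖ < 1 → EvalAt (P N) q (F N q))
    (h : TendstoLocallyUniformlyOn F f Filter.atTop (Metric.ball 0 1)) :
    ∃ Q : ℤ⟦X⟧, ∀ q, ‖q‖ < 1 → EvalAt Q q (f q) := by
  have hf := h.differentiableOn (.of_forall hF) Metric.isOpen_ball
  have hcoeff : ∀ N n, ((PowerSeries.coeff n (P N) : ℤ) : ℂ) =
      (n.factorial : ℂ)⁻¹ * iteratedDeriv n (F N) 0 := by
    intro N n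
    have := EvalAt.unique (fun q hq => (hP N q hq).map)
      (fun q hq => evalAt_of_differentiableOn (hF N) hq)
    simpa using congr_arg (PowerSeries.coeff n) this
  have hint : ∀ n, ∃ z : ℤ, (z : ℂ) = (n.factorial : ℂ)⁻¹ * iteratedDeriv n f 0 := by
    intro n
    have h1 := ((iteratedDeriv_tendsto Metric.isOpen_ball hF h n).tendsto_at
      (Metric.mem_ball_self one_pos)).const_mul ((n.factorial : ℂ)⁻¹)
    exact Complex.isClosed_range_intCast.mem_of_tendsto h1 (.of_forall fun N => ⟨_, hcoeff N n⟩)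
  choose z hz using hint
  refine ⟨PowerSeries.mk z, fun q hq => ?_⟩
  simpa [EvalAt, hz] using evalAt_of_differentiableOn hf hq

lemma exists_evalAt_int_inv {A : ℂ → ℂ} {P : ℤ⟦X⟧} (hP1 : PowerSeries.constantCoeff P = 1)
    (hP : ∀ q, ‖q‖ < 1 → EvalAt P q (A q)) (hA : ∀ q, ‖q‖ < 1 → A q ≠ 0) :
    ∃ Q : ℤ⟦X⟧, PowerSeries.constantCoeff Q = 1 ∧ ∀ q, ‖q‖ < 1 → EvalAt Q q (A q)⁻¹ := by
  have hd : DifferentiableOn ℂ A (Metric.ball 0 1) := by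
    have := (EvalAt.hasFPowerSeriesOnBall (fun q hq => (hP q hq).map)).differentiableOn
    rwa [← ENNReal.coe_one, Metric.eball_coe, NNReal.coe_one] at this
  have hi : DifferentiableOn ℂ (fun q => (A q)⁻¹) (Metric.ball 0 1) :=
    hd.inv fun q hq => hA q (by simpa using hq)
  set Q := PowerSeries.invOfUnit P 1
  have hPQ : P * Q = 1 := PowerSeries.mul_invOfUnit P 1 (by simpa using hP1)
  have hev := fun q (hq : ‖q‖ < 1) => evalAt_of_differentiableOn hi hq
  set S := PowerSeries.mk fun n => (n.factorial : ℂ)⁻¹ * iteratedDeriv n (fun q => (A q)⁻¹) 0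
  have hPS : P.map (algebraMap ℤ ℂ) * S = 1 := by
    refine EvalAt.unique (A := fun _ => 1) (fun q hq => ?_) (fun q _ => EvalAt.one)
    simpa [hA q hq] using (hP q hq).map.mul (hev q hq)
  have hQS : Q.map (algebraMap ℤ ℂ) = S := by
    have : P.map (algebraMap ℤ ℂ) * Q.map (algebraMap ℤ ℂ) = 1 := by
      rw [← map_mul, hPQ, map_one]
    calc _ = Q.map (algebraMap ℤ ℂ) * (P.map (algebraMap ℤ ℂ) * S) := by rw [hPS, mul_one]
      _ = (P.map (algebraMap ℤ ℂ) * Q.map (algebraMap ℤ ℂ)) * S := by ring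
      _ = S := by rw [this, one_mul]
  refine ⟨Q, by simp [Q], fun q hq => ?_⟩
  have := hev q hq
  rw [← hQS] at this
  simpa [EvalAt] using this

/-- Euler's product `∏ (1 - qⁿ)`. -/
def eulerProd (q : ℂ) : ℂ := ∏' n : ℕ, (1 - q ^ (n + 1))

lemma eulerProd_ne_zero {q : ℂ} (hq : ‖q‖ < 1) : eulerProd q ≠ 0 := by
  have := tprod_one_add_ne_zero_of_summable (f := fun n : ℕ ↦ -q ^ (n + 1)) ?_ ?_
  · simpa [eulerProd, sub_eq_add_neg] using this
  · intro n h
    have h1 : q ^ (n + 1) = 1 := by linear_combination -h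
    have := pow_lt_one₀ (norm_nonneg q) hq (Nat.succ_ne_zero n)
    rw [← norm_pow, h1] at this
    simp at this
  · simpa using (summable_nat_add_iff 1).mpr (summable_geometric_of_lt_one (norm_nonneg _) hq)

lemma exists_evalAt_eulerProd :
    ∃ P : ℤ⟦X⟧, PowerSeries.constantCoeff P = 1 ∧ ∀ q, ‖q‖ < 1 → EvalAt P q (eulerProd q) := by
  have h := ModularForm.multipliableLocallyUniformlyOn_one_sub_pow.hasProdLocallyUniformlyOn
  have h2 : TendstoLocallyUniformlyOn (fun (N : ℕ) q => ∏ n ∈ Finset.range N, (1 - q ^ (n + 1)))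
      eulerProd Filter.atTop (Metric.ball (0 : ℂ) 1) := by
    exact h.tendstoLocallyUniformlyOn_finsetRange
  have hev : ∀ N : ℕ, ∀ q : ℂ, ‖q‖ < 1 →
      EvalAt (∏ n ∈ Finset.range N, (1 - PowerSeries.X ^ (n + 1) : ℤ⟦X⟧)) q
        (∏ n ∈ Finset.range N, (1 - q ^ (n + 1))) := by
    intro N q _
    induction N with
    | zero => simpa using EvalAt.one
    | succ N ih =>
      simp only [Finset.prod_range_succ]
      exact ih.mul (EvalAt.one.sub (EvalAt.X.pow _))
  obtain ⟨P, hP⟩ := exists_evalAt_int (fun N => by fun_prop) hev h2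
  refine ⟨P, ?_, hP⟩
  have h0 := hP 0 (by simp)
  have h1 := HasSum.unique h0 (hasSum_single 0 fun n hn => by simp [hn])
  simpa [eulerProd] using h1.symm

/-- The square of the Dedekind eta function. -/
def etaSq (τ : ℍ) : ℂ := ModularForm.eta τ ^ 2

/-- A primitive twelfth root of unity. -/
def zetaTwelve : ℂ := cexp (2 * π * Complex.I / 12)

lemma zetaTwelve_zpow_of_dvd {n : ℤ} (h : (12 : ℤ) ∣ n) : zetaTwelve ^ n = 1 := by
  obtain ⟨k, rfl⟩ := h
  rw [zetaTwelve, ← Complex.exp_int_mul, Complex.exp_eq_one_iff]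
  exact ⟨k, by push_cast; ring⟩

lemma zetaTwelve_ne_zero : zetaTwelve ≠ 0 := Complex.exp_ne_zero _

lemma zetaTwelve_zpow_congr {m n : ℤ} (h : m ≡ n [ZMOD 12]) : zetaTwelve ^ m = zetaTwelve ^ n := by
  have := zetaTwelve_zpow_of_dvd h.symm.dvd
  rwa [zpow_sub₀ zetaTwelve_ne_zero, div_eq_one_iff_eq (zpow_ne_zero _ zetaTwelve_ne_zero)] at this

lemma etaSq_eq (τ : ℍ) :
    etaSq τ = cexp (2 * π * Complex.I * τ / 12) * eulerProd (qexp τ) ^ 2 := by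
  have h1 : ModularForm.eta τ = cexp (2 * π * Complex.I * τ / 24) * eulerProd (qexp τ) := by
    simp [ModularForm.eta, ModularForm.eta_q_eq_pow, eulerProd, qexp, Function.Periodic.qParam]
  rw [etaSq, h1, mul_pow, ← Complex.exp_nat_mul]
  congr 2
  push_cast
  ring

lemma norm_qexp_lt_one (τ : ℍ) : ‖qexp τ‖ < 1 := norm_exp_two_pi_I_lt_one τ

lemma qexp_ne_zero (τ : ℍ) : qexp τ ≠ 0 := Complex.exp_ne_zero _

lemma etaSq_ne_zero (τ : ℍ) : etaSq τ ≠ 0 :=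
  pow_ne_zero _ (ModularForm.eta_ne_zero τ.2)

lemma etaSq_T_smul (τ : ℍ) : etaSq (ModularGroup.T • τ) = zetaTwelve * etaSq τ := by
  have h : qexp (ModularGroup.T • τ) = qexp τ := by
    rw [qexp, qexp, modular_T_smul, Complex.exp_eq_exp_iff_exists_int]
    exact ⟨1, by simp; ring⟩
  rw [etaSq_eq, etaSq_eq, h, ← mul_assoc, zetaTwelve, ← Complex.exp_add]
  congr 2
  rw [modular_T_smul]
  simp
  ring

lemma etaSq_S_smul (τ : ℍ) : etaSq (ModularGroup.S • τ) = -Complex.I * τ * etaSq τ := by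
  have h := ModularForm.eta_comp_eq_csqrt_I_inv τ.2
  have h1 : ((ModularGroup.S • τ : ℍ) : ℂ) = -1 / τ := by
    rw [modular_S_smul]
    simp [neg_div, inv_neg]
  have h2 : ∀ z : ℂ, z ≠ 0 → sqrt z ^ 2 = z := by
    intro z hz
    simp [sqrt]
  simp only [Function.comp_apply, Pi.smul_apply, Pi.mul_apply, smul_eq_mul] at h
  rw [etaSq, h1, h, mul_pow, mul_pow, inv_pow, h2 _ Complex.I_ne_zero, h2 _ τ.ne_zero, etaSq,
    Complex.inv_I]
  ring

/-- The exponent of the multiplier of `η²`, as a polynomial in the matrix entries. -/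
def etaExponent {R : Type*} [CommRing R] (a b c d : R) : R :=
  (1 - c ^ 2) * (b * d + 3 * (c - 1) * d + c + 3) + c * (a + d - 3)

lemma intCast_etaExponent {R : Type*} [CommRing R] (a b c d : ℤ) :
    ((etaExponent a b c d : ℤ) : R) = etaExponent (a : R) b c d := by
  simp [etaExponent]

lemma modEq_twelve {m n : ℤ} (h3 : (m : ZMod 3) = n) (h4 : (m : ZMod 4) = n) :
    m ≡ n [ZMOD 12] := by
  have h3 := (ZMod.intCast_eq_intCast_iff _ _ _).mp h3
  have h4 := (ZMod.intCast_eq_intCast_iff _ _ _).mp h4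
  exact (Int.modEq_and_modEq_iff_modEq_mul (by decide : (3 : ℤ).natAbs.Coprime (4 : ℤ).natAbs)).mp
    ⟨h3, h4⟩

lemma etaExponent_mul_S {a b c d : ℤ} (h : a * d - b * c = 1) :
    etaExponent b (-a) d (-c) ≡ etaExponent a b c d - 3 [ZMOD 12] := by
  apply modEq_twelve
  · have key : ∀ a b c d : ZMod 3, a * d - b * c = 1 →
        etaExponent b (-a) d (-c) = etaExponent a b c d - 3 := by
      unfold etaExponent; decide
    push_cast [intCast_etaExponent]
    exact key _ _ _ _ (by exact_mod_cast congr_arg (Int.cast : ℤ → ZMod 3) h)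
  · have key : ∀ a b c d : ZMod 4, a * d - b * c = 1 →
        etaExponent b (-a) d (-c) = etaExponent a b c d - 3 := by
      unfold etaExponent; decide
    push_cast [intCast_etaExponent]
    exact key _ _ _ _ (by exact_mod_cast congr_arg (Int.cast : ℤ → ZMod 4) h)

lemma etaExponent_mul_T {a b c d : ℤ} (h : a * d - b * c = 1) :
    etaExponent a (a + b) c (c + d) ≡ etaExponent a b c d + 1 [ZMOD 12] := by
  apply modEq_twelve
  · have key : ∀ a b c d : ZMod 3, a * d - b * c = 1 →
        etaExponent a (a + b) c (c + d) = etaExponent a b c d + 1 := by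
      unfold etaExponent; decide
    push_cast [intCast_etaExponent]
    exact key _ _ _ _ (by exact_mod_cast congr_arg (Int.cast : ℤ → ZMod 3) h)
  · have key : ∀ a b c d : ZMod 4, a * d - b * c = 1 →
        etaExponent a (a + b) c (c + d) = etaExponent a b c d + 1 := by
      unfold etaExponent; decide
    push_cast [intCast_etaExponent]
    exact key _ _ _ _ (by exact_mod_cast congr_arg (Int.cast : ℤ → ZMod 4) h)

/-- The automorphy factor `cτ + d`. -/
def autFactor (γ : SL(2, ℤ)) (τ : ℍ) : ℂ := γ 1 0 * τ + γ 1 1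

lemma denom_eq_autFactor (γ : SL(2, ℤ)) (τ : ℍ) : denom γ τ = autFactor γ τ := by
  simp [autFactor, ModularGroup.denom_apply]

lemma autFactor_ne_zero (γ : SL(2, ℤ)) (τ : ℍ) : autFactor γ τ ≠ 0 := by
  rw [← denom_eq_autFactor]
  exact denom_ne_zero _ _

lemma coe_smul_eq (γ : SL(2, ℤ)) (τ : ℍ) :
    ((γ • τ : ℍ) : ℂ) = (γ 0 0 * τ + γ 0 1) / autFactor γ τ := by
  rw [coe_specialLinearGroup_apply]
  simp [autFactor]

lemma autFactor_mul (γ δ : SL(2, ℤ)) (τ : ℍ) :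
    autFactor (γ * δ) τ = autFactor γ (δ • τ) * autFactor δ τ := by
  have := autFactor_ne_zero δ τ
  rw [autFactor, autFactor, coe_smul_eq]
  field_simp
  simp [autFactor, Matrix.mul_apply, Fin.sum_univ_two]
  ring

/-- `η²` transforms under `γ` with the multiplier given by `etaExponent`. -/
def EtaSqTransforms (γ : SL(2, ℤ)) : Prop :=
  ∀ τ : ℍ, etaSq (γ • τ) = zetaTwelve ^ etaExponent (γ 0 0) (γ 0 1) (γ 1 0) (γ 1 1) *
    autFactor γ τ * etaSq τ

lemma etaSqTransforms_mul_iff {x y : SL(2, ℤ)} {n : ℤ}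
    (hy : ∀ τ : ℍ, etaSq (y • τ) = zetaTwelve ^ n * autFactor y τ * etaSq τ)
    (h : etaExponent ((x * y) 0 0) ((x * y) 0 1) ((x * y) 1 0) ((x * y) 1 1) ≡
      etaExponent (x 0 0) (x 0 1) (x 1 0) (x 1 1) + n [ZMOD 12]) :
    EtaSqTransforms (x * y) ↔ EtaSqTransforms x := by
  refine Iff.trans (forall_congr' fun τ => ?_) (MulAction.surjective y).forall.symm
  rw [mul_smul, hy, zetaTwelve_zpow_congr h, autFactor_mul, zpow_add₀ zetaTwelve_ne_zero]
  ring_nf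

lemma etaSqTransforms (γ : SL(2, ℤ)) : EtaSqTransforms γ := by
  have hS : ∀ x : SL(2, ℤ), EtaSqTransforms (x * ModularGroup.S) ↔ EtaSqTransforms x := by
    intro x
    refine etaSqTransforms_mul_iff (n := -3) (fun τ => ?_) ?_
    · have h3 : zetaTwelve ^ (-3 : ℤ) = -Complex.I := by
        have h : -Complex.I = cexp (-(π / 2 * Complex.I)) := by
          rw [Complex.exp_neg, Complex.exp_pi_div_two_mul_I, Complex.inv_I]
        rw [zetaTwelve, ← Complex.exp_int_mul, h]
        congr 1
        push_cast
        ring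
      rw [etaSq_S_smul, h3]
      simp [autFactor, ModularGroup.S]
    · have h := x.det_coe
      rw [Matrix.det_fin_two] at h
      simpa [Matrix.SpecialLinearGroup.coe_mul, ModularGroup.coe_S, Matrix.mul_apply,
        Fin.sum_univ_two, sub_eq_add_neg] using etaExponent_mul_S h
  have hT : ∀ x : SL(2, ℤ), EtaSqTransforms (x * ModularGroup.T) ↔ EtaSqTransforms x := by
    intro x
    refine etaSqTransforms_mul_iff (n := 1) (fun τ => ?_) ?_
    · rw [etaSq_T_smul]
      simp [autFactor, ModularGroup.T]
    · have h := x.det_coe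
      rw [Matrix.det_fin_two] at h
      simpa [Matrix.SpecialLinearGroup.coe_mul, ModularGroup.coe_T, Matrix.mul_apply,
        Fin.sum_univ_two] using etaExponent_mul_T h
  have : γ ∈ Subgroup.closure {ModularGroup.S, ModularGroup.T} := by
    simp [SpecialLinearGroup.SL2Z_generators]
  induction this using Subgroup.closure_induction_right with
  | one =>
    intro τ
    simp [autFactor, etaExponent]
  | mul_right x _ y hy ih =>
    rcases hy with rfl | rfl
    · exact (hS x).mpr ih
    · exact (hT x).mpr ih
  | mul_inv_cancel x _ y hy ih =>
    rcases hy with rfl | rfl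
    · exact (hS _).mp (by simpa using ih)
    · exact (hT _).mp (by simpa using ih)

/-- `f` transforms with weight `k` under all elements of `Γ`. -/
def TransformsUnder (Γ : Subgroup SL(2, ℤ)) (k : ℕ) (f : ℍ → ℂ) : Prop :=
  ∀ γ ∈ Γ, ∀ τ : ℍ, f (γ • τ) = autFactor γ τ ^ k * f τ

lemma slash_eq_iff (k : ℕ) (f : ℍ → ℂ) (γ : SL(2, ℤ)) :
    f ∣[(k : ℤ)] γ = f ↔ ∀ τ : ℍ, f (γ • τ) = autFactor γ τ ^ k * f τ := by
  rw [funext_iff]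
  refine forall_congr' fun τ => ?_
  rw [ModularForm.slash_action_eq'_iff, autFactor, zpow_natCast]

lemma TransformsUnder.mono {Γ Γ' : Subgroup SL(2, ℤ)} (h : Γ' ≤ Γ) {k : ℕ} {f : ℍ → ℂ}
    (hf : TransformsUnder Γ k f) : TransformsUnder Γ' k f :=
  fun γ hγ => hf γ (h hγ)

lemma TransformsUnder.sub {Γ : Subgroup SL(2, ℤ)} {k : ℕ} {f g : ℍ → ℂ}
    (hf : TransformsUnder Γ k f) (hg : TransformsUnder Γ k g) :
    TransformsUnder Γ k (fun τ => f τ - g τ) := fun γ hγ τ => by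
  simp only [hf γ hγ, hg γ hγ]
  ring

lemma TransformsUnder.mul {Γ : Subgroup SL(2, ℤ)} {k l : ℕ} {f g : ℍ → ℂ}
    (hf : TransformsUnder Γ k f) (hg : TransformsUnder Γ l g) :
    TransformsUnder Γ (k + l) (fun τ => f τ * g τ) := fun γ hγ τ => by
  simp only [hf γ hγ, hg γ hγ]
  ring

lemma WhmForm.transformsUnder {Γ : Subgroup SL(2, ℤ)} {k : ℕ} (f : WhmForm Γ k) :
    TransformsUnder Γ k f.toFun :=
  fun γ hγ => (slash_eq_iff k f.toFun γ).mp (f.slash_eq γ hγ)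

/-- `δ` is the conjugate of `γ` by `diag(p, 1)`. -/
structure IsDiagConj (p : ℕ) (γ δ : SL(2, ℤ)) : Prop where
  h00 : δ 0 0 = γ 0 0
  h01 : δ 0 1 = p * γ 0 1
  h10 : p * δ 1 0 = γ 1 0
  h11 : δ 1 1 = γ 1 1

lemma exists_isDiagConj_of_mem_Gamma0 {p : ℕ} {γ : SL(2, ℤ)} (hγ : γ ∈ Gamma0 p) :
    ∃ δ : SL(2, ℤ), IsDiagConj p γ δ := by
  obtain ⟨c, hc⟩ := (ZMod.intCast_zmod_eq_zero_iff_dvd _ _).mp (Gamma0_mem.mp hγ)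
  have h := γ.det_coe
  rw [Matrix.det_fin_two, hc] at h
  refine ⟨⟨!![γ 0 0, p * γ 0 1; c, γ 1 1], ?_⟩, ⟨?_, ?_, ?_, ?_⟩⟩
  · rw [Matrix.det_fin_two_of]
    linear_combination h
  all_goals simp [hc]

lemma IsDiagConj.autFactor_rscale {p : ℕ} (hp : (0 : ℝ) < p) {γ δ : SL(2, ℤ)} (h : IsDiagConj p γ δ)
    (τ : ℍ) : autFactor δ (rscale p hp τ) = autFactor γ τ := by
  simp only [autFactor, rscale, ← h.h10, h.h11]
  push_cast
  ring

lemma IsDiagConj.rscale_smul {p : ℕ} (hp : (0 : ℝ) < p) {γ δ : SL(2, ℤ)} (h : IsDiagConj p γ δ)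
    (τ : ℍ) : rscale p hp (γ • τ) = δ • rscale p hp τ := by
  ext
  rw [coe_smul_eq, h.autFactor_rscale hp]
  simp only [rscale, coe_smul_eq, h.h00, h.h01]
  push_cast
  ring

lemma TransformsUnder.comp_rscale {p : ℕ} (hp : (0 : ℝ) < p) {k : ℕ} {f : ℍ → ℂ}
    (hf : TransformsUnder ⊤ k f) : TransformsUnder (Gamma0 p) k (fun τ => f (rscale p hp τ)) := by
  intro γ hγ τ
  obtain ⟨δ, hδ⟩ := exists_isDiagConj_of_mem_Gamma0 hγ
  simp only [hδ.rscale_smul hp, hf δ trivial, hδ.autFactor_rscale hp]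

lemma TransformsUnder.neginv {k : ℕ} {f : ℍ → ℂ} (hf : TransformsUnder ⊤ k f) (τ : ℍ) :
    f (neginv τ) = τ ^ k * f τ := by
  have := hf ModularGroup.S trivial τ
  rw [modular_S_smul] at this
  simpa [autFactor, ModularGroup.S, _root_.neginv] using this

lemma rscale_neginv_rscale {p : ℕ} (hp : (0 : ℝ) < p) (τ : ℍ) :
    rscale p hp (neginv (rscale p hp τ)) = neginv τ := by
  ext
  have : (p : ℂ) ≠ 0 := by exact_mod_cast hp.ne'
  have := τ.ne_zero
  simp [rscale, neginv]
  field_simp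

lemma qexp_rscale {p : ℕ} (hp : (0 : ℝ) < p) (τ : ℍ) : qexp (rscale p hp τ) = qexp τ ^ p := by
  rw [qexp, qexp, ← Complex.exp_nat_mul]
  simp only [rscale]
  congr 1
  push_cast
  ring

/-- The eta quotient `(η(pτ) / η(τ)) ^ (2 t)`. -/
def etaQuot {p : ℕ} (hp : (0 : ℝ) < p) (t : ℕ) (τ : ℍ) : ℂ :=
  (etaSq (rscale p hp τ) / etaSq τ) ^ t

lemma etaExponent_modEq {n a b c d a' b' c' d' : ℤ} (ha : a ≡ a' [ZMOD n]) (hb : b ≡ b' [ZMOD n])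
    (hc : c ≡ c' [ZMOD n]) (hd : d ≡ d' [ZMOD n]) :
    etaExponent a b c d ≡ etaExponent a' b' c' d' [ZMOD n] := by
  unfold etaExponent
  gcongr

lemma etaQuot_smul {p t : ℕ} (hp : (0 : ℝ) < p) (ht : ((p : ℤ) - 1) * t = 12) {γ : SL(2, ℤ)}
    (hγ : γ ∈ Gamma0 p) (τ : ℍ) : etaQuot hp t (γ • τ) = etaQuot hp t τ := by
  obtain ⟨δ, hδ⟩ := exists_isDiagConj_of_mem_Gamma0 hγ
  have hp1 : (p : ℤ) ≡ 1 [ZMOD (p - 1)] := (Int.modEq_iff_dvd.mpr (by simp)).symm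
  have h1 := etaExponent_modEq (n := p - 1) (Int.ModEq.refl (γ 0 0))
    (show γ 0 1 ≡ δ 0 1 [ZMOD (p - 1)] by
      rw [hδ.h01]; simpa using (hp1.mul_right (γ 0 1)).symm)
    (show γ 1 0 ≡ δ 1 0 [ZMOD (p - 1)] by
      rw [← hδ.h10]; simpa using hp1.mul_right (δ 1 0)) (Int.ModEq.refl (γ 1 1))
  have h2 : etaExponent (γ 0 0) (γ 0 1) (γ 1 0) (γ 1 1) * t ≡
      etaExponent (δ 0 0) (δ 0 1) (δ 1 0) (δ 1 1) * t [ZMOD 12] := by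
    rw [hδ.h00, hδ.h11, ← ht]
    exact h1.mul_right'
  have h3 := zetaTwelve_zpow_congr h2
  rw [zpow_mul, zpow_mul, zpow_natCast, zpow_natCast] at h3
  have := autFactor_ne_zero γ τ
  have := etaSq_ne_zero τ
  have := zpow_ne_zero (etaExponent (γ 0 0) (γ 0 1) (γ 1 0) (γ 1 1)) zetaTwelve_ne_zero
  have := zpow_ne_zero (etaExponent (δ 0 0) (δ 0 1) (δ 1 0) (δ 1 1)) zetaTwelve_ne_zero
  rw [etaQuot, hδ.rscale_smul hp, etaSqTransforms, etaSqTransforms γ, hδ.autFactor_rscale hp,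
    etaQuot, div_pow, div_pow, mul_pow, mul_pow, mul_pow, mul_pow, ← h3]
  field_simp

lemma etaQuot_neginv_rscale {p : ℕ} (hp : (0 : ℝ) < p) (t : ℕ) (τ : ℍ) :
    p ^ t * etaQuot hp t (neginv (rscale p hp τ)) = (etaQuot hp t τ)⁻¹ := by
  have hS : ∀ τ : ℍ, etaSq (neginv τ) = -Complex.I * τ * etaSq τ := by
    intro τ
    rw [← etaSq_S_smul, modular_S_smul]
    rfl
  have hp0 : (p : ℂ) ≠ 0 := by exact_mod_cast hp.ne'
  have := τ.ne_zero
  have := etaSq_ne_zero τ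
  have := etaSq_ne_zero (rscale p hp τ)
  rw [etaQuot, rscale_neginv_rscale, hS, hS, etaQuot, ← mul_pow, ← inv_pow]
  congr 1
  have h1 : ((rscale p hp τ : ℍ) : ℂ) = p * τ := by simp [rscale]
  rw [h1]
  have := Complex.I_ne_zero
  field_simp

lemma etaQuot_eq {p t : ℕ} (hp : (0 : ℝ) < p) (ht : ((p : ℤ) - 1) * t = 12) (τ : ℍ) :
    etaQuot hp t τ = qexp τ * (eulerProd (qexp τ ^ p) / eulerProd (qexp τ)) ^ (2 * t) := by
  have ht' : ((p : ℂ) - 1) * t = 12 := by exact_mod_cast ht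
  have h1 : ((rscale p hp τ : ℍ) : ℂ) = p * τ := by simp [rscale]
  have h : (cexp (2 * π * Complex.I * (p * τ) / 12) / cexp (2 * π * Complex.I * τ / 12)) ^ t
      = qexp τ := by
    rw [← Complex.exp_sub, ← Complex.exp_nat_mul, qexp]
    congr 1
    linear_combination (2 * π * Complex.I * τ / 12) * ht'
  rw [etaQuot, etaSq_eq, etaSq_eq, qexp_rscale, mul_div_mul_comm, mul_pow, h1, h, ← div_pow,
    ← pow_mul]

lemma exists_evalAt_etaQuot {p t : ℕ} (hp : (0 : ℝ) < p) (ht : ((p : ℤ) - 1) * t = 12) :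
    (∃ V : ℤ⟦X⟧, ∀ τ, EvalAt (PowerSeries.X * V) (qexp τ) (etaQuot hp t τ)) ∧
    ∃ U : ℤ⟦X⟧, PowerSeries.constantCoeff U = 1 ∧
      ∀ τ, EvalAt U (qexp τ) (qexp τ * (etaQuot hp t τ)⁻¹) := by
  have hp0 : p ≠ 0 := by rintro rfl; simp at hp
  obtain ⟨P, hP1, hP⟩ := exists_evalAt_eulerProd
  obtain ⟨Q, hQ1, hQ⟩ := exists_evalAt_int_inv hP1 hP fun q => eulerProd_ne_zero
  have hq : ∀ τ : ℍ, ‖qexp τ ^ p‖ < 1 := fun τ => by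
    rw [← qexp_rscale hp]; exact norm_qexp_lt_one _
  refine ⟨⟨(PowerSeries.expand p hp0 P * Q) ^ (2 * t), fun τ => ?_⟩,
    (P * PowerSeries.expand p hp0 Q) ^ (2 * t), ?_, fun τ => ?_⟩
  · rw [etaQuot_eq hp ht, div_eq_mul_inv]
    exact EvalAt.X.mul ((((hP _ (hq τ)).expand hp0).mul (hQ _ (norm_qexp_lt_one τ))).pow _)
  · rw [map_pow, map_mul, hP1, PowerSeries.constantCoeff_expand, hQ1]
    simp
  · rw [etaQuot_eq hp ht, mul_inv, mul_inv_cancel_left₀ (qexp_ne_zero τ), ← inv_pow, inv_div,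
      div_eq_mul_inv]
    exact ((hP _ (norm_qexp_lt_one τ)).mul ((hQ _ (hq τ)).expand hp0)).pow _

/-- `f` is an integral level one form of weight `k` with constant term `1`. -/
def IsNormalizedIntegral (k : ℕ) (f : ℍ → ℂ) : Prop :=
  TransformsUnder ⊤ k f ∧
    ∃ P : ℤ⟦X⟧, PowerSeries.constantCoeff P = 1 ∧ ∀ τ, EvalAt P (qexp τ) (f τ)

lemma IsNormalizedIntegral.mul {k l : ℕ} {f g : ℍ → ℂ} (hf : IsNormalizedIntegral k f)
    (hg : IsNormalizedIntegral l g) : IsNormalizedIntegral (k + l) (fun τ => f τ * g τ) := by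
  obtain ⟨hf, P, hP1, hP⟩ := hf
  obtain ⟨hg, Q, hQ1, hQ⟩ := hg
  exact ⟨hf.mul hg, P * Q, by simp [hP1, hQ1], fun τ => (hP τ).mul (hQ τ)⟩

lemma bernoulli_six : bernoulli 6 = 1 / 42 := by
  have : bernoulli' 5 = 0 := bernoulli'_eq_zero_of_odd (by decide) (by norm_num)
  have : Nat.choose 6 2 = 15 := by decide
  have : Nat.choose 6 4 = 15 := by decide
  rw [bernoulli_eq_bernoulli'_of_ne_one (by norm_num), bernoulli'_def]
  norm_num [Finset.sum_range_succ, *]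

lemma isNormalizedIntegral_E {k : ℕ} (hk : 3 ≤ k) (hk2 : Even k) (r : ℤ)
    (hr : -(2 * k / bernoulli k : ℚ) = r) :
    IsNormalizedIntegral k (ModularForm.E hk) := by
  have hr' : -(2 * k / bernoulli k : ℂ) = r := by exact_mod_cast congr_arg (Rat.cast : ℚ → ℂ) hr
  refine ⟨fun γ _ τ => ?_, PowerSeries.mk fun n =>
    if n = 0 then 1 else r * ArithmeticFunction.sigma (k - 1) n, ?_, fun τ => ?_⟩
  · rw [← denom_eq_autFactor, ← zpow_natCast]
    exact SlashInvariantForm.slash_action_eqn'' (ModularForm.E hk)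
      (MonoidHom.mem_range.mpr ⟨γ, rfl⟩) τ
  · rw [← PowerSeries.coeff_zero_eq_constantCoeff_apply, PowerSeries.coeff_mk, if_pos rfl]
  · have := ModularForm.hasSum_qExpansion (ModularForm.E hk) one_pos
      (by simp) τ
    refine this.congr_fun fun n => ?_
    rw [EisensteinSeries.E_qExpansion_coeff hk hk2, hr']
    have h1 : Function.Periodic.qParam 1 τ = qexp τ := by
      simp [Function.Periodic.qParam, qexp]
    rw [h1, PowerSeries.coeff_mk]
    split_ifs <;> simp

lemma exists_isNormalizedIntegral {k : ℕ} (hk : k ∈ ({4, 6, 8, 10, 14} : Set ℕ)) :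
    ∃ f, IsNormalizedIntegral k f := by
  have h4 := isNormalizedIntegral_E (k := 4) (by norm_num) ⟨2, rfl⟩ 240
    (by norm_num [bernoulli_eq_bernoulli'_of_ne_one, bernoulli'_four])
  have h6 := isNormalizedIntegral_E (k := 6) (by norm_num) ⟨3, rfl⟩ (-504)
    (by norm_num [bernoulli_six])
  rcases hk with rfl | rfl | rfl | rfl | rfl
  exacts [⟨_, h4⟩, ⟨_, h6⟩, ⟨_, h4.mul h4⟩, ⟨_, h4.mul h6⟩, ⟨_, (h4.mul h4).mul h6⟩]

open Polynomial in
/-- If `q ^ N * h` has an integral expansion, then the poles of `h` at `∞` can be cancelled by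
an integral polynomial without constant term in the function `ψ = q⁻¹ + ⋯`, times `E`. -/
lemma exists_polynomial_sub {ι : Type*} {q E ψ : ι → ℂ} {U V : ℤ⟦X⟧} (hq : ∀ τ, q τ ≠ 0)
    (hU1 : PowerSeries.constantCoeff U = 1) (hU : ∀ τ, EvalAt U (q τ) (q τ * ψ τ))
    (hV1 : PowerSeries.constantCoeff V = 1) (hV : ∀ τ, EvalAt V (q τ) (E τ)) (N : ℕ) :
    ∀ (h : ι → ℂ) (W : ℤ⟦X⟧), (∀ τ, EvalAt W (q τ) (q τ ^ N * h τ)) →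
      ∃ (c : ℤ[X]) (P : ℤ⟦X⟧), ∀ τ, EvalAt P (q τ) (h τ - E τ * aeval (ψ τ) (X * c)) := by
  induction N with
  | zero =>
    intro h W hW
    exact ⟨0, W, fun τ => by simpa using hW τ⟩
  | succ N ih =>
    intro h W hW
    set w := PowerSeries.constantCoeff W
    obtain ⟨W', hW'⟩ : (PowerSeries.X : ℤ⟦X⟧) ∣ W - PowerSeries.C w * (V * U ^ (N + 1)) := by
      rw [PowerSeries.X_dvd_iff]
      simp [hU1, hV1, w]
    obtain ⟨c, P, hP⟩ := ih (fun τ => h τ - w * (E τ * ψ τ ^ (N + 1))) W' fun τ => by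
      refine EvalAt.exists_of_X_mul (hq τ) ?_
      rw [← hW']
      have := (hW τ).sub ((EvalAt.C w).mul ((hV τ).mul ((hU τ).pow (N + 1))))
      convert this using 1
      simp only [eq_intCast]
      ring
    refine ⟨c + C w * X ^ N, P, fun τ => ?_⟩
    convert hP τ using 1
    simp
    ring

/-- The expansion of a weakly holomorphic form with the principal part removed. -/
lemma WhmForm.evalAt_sub {Γ : Subgroup SL(2, ℤ)} {k : ℤ} {M : ℕ} (hM : 0 < M) {f : WhmForm Γ k}
    (hf : IsBasisElt k 0 M f) {a : ℤ → ℤ} (ha : ∀ n : ℤ, 0 < n → f.coeff n = a n) (τ : ℍ) :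
    EvalAt (PowerSeries.mk fun n => if n = 0 then 0 else a n) (qexp τ)
      (f.toFun τ - (qexp τ ^ M)⁻¹) := by
  have h1 : HasSum (fun n : ℤ => if n = -M then qexp τ ^ n else 0) ((qexp τ ^ M)⁻¹) := by
    have := hasSum_ite_eq (-(M : ℤ)) (qexp τ ^ (-(M : ℤ)))
    rw [zpow_neg, zpow_natCast] at this
    refine this.congr_fun fun n => ?_
    split_ifs with h
    · rw [h, zpow_neg, zpow_natCast]
    · rfl
  have h2 := (f.expansion.2 τ).sub h1
  have hinj : Function.Injective ((↑) : ℕ → ℤ) := Nat.cast_injective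
  rw [← hinj.hasSum_iff] at h2
  · refine h2.congr_fun fun n => ?_
    have hn : (n : ℤ) ≠ -M := by omega
    simp only [Function.comp_apply, if_neg hn, PowerSeries.coeff_mk, zpow_natCast, sub_zero]
    split_ifs with h
    · subst h
      rw [hf.2 _ hn le_rfl]
      simp
    · rw [ha n (by omega)]
      simp
  · intro n hn
    have hn0 : n < 0 := by
      by_contra! h
      exact hn ⟨n.toNat, by simpa using h⟩
    by_cases h : n = -M
    · simp [h, hf.1]
    · simp [h, hf.2 n h hn0.le]

/-- The function with `q`-expansion `P`. -/
lemma exists_differentiableOn_of_evalAt {P : ℤ⟦X⟧} {f : ℍ → ℂ}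
    (hP : ∀ τ, EvalAt P (qexp τ) (f τ)) :
    ∃ A : ℂ → ℂ, DifferentiableOn ℂ A (Metric.ball 0 1) ∧ ∀ τ, f τ = A (qexp τ) := by
  have hs : ∀ q : ℂ, ‖q‖ < 1 → EvalAt P q
      (∑' n, algebraMap ℤ ℂ (PowerSeries.coeff n P) * q ^ n) := by
    intro q hq
    refine Summable.hasSum ?_
    by_cases hq0 : q = 0
    · refine (hasSum_single 0 fun n hn => ?_).summable
      simp [hq0, hn]
    · have h1 := Function.Periodic.im_invQParam_pos_of_norm_lt_one one_pos hq hq0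
      have h2 := Function.Periodic.qParam_right_inv one_ne_zero hq0
      have h3 : qexp ⟨_, h1⟩ = q := by
        conv_rhs => rw [← h2]
        simp [qexp, Function.Periodic.qParam]
      have := (hP ⟨_, h1⟩).summable
      rwa [h3] at this
  refine ⟨fun q => ∑' n, algebraMap ℤ ℂ (PowerSeries.coeff n P) * q ^ n, ?_,
    fun τ => HasSum.unique (hP τ) (hs _ (norm_qexp_lt_one τ))⟩
  have := (EvalAt.hasFPowerSeriesOnBall (fun q hq => (hs q hq).map)).differentiableOn
  rwa [← ENNReal.coe_one, Metric.eball_coe, NNReal.coe_one] at this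

lemma mdifferentiable_of_evalAt {P : ℤ⟦X⟧} {f : ℍ → ℂ} (hP : ∀ τ, EvalAt P (qexp τ) (f τ)) :
    MDifferentiable 𝓘(ℂ) 𝓘(ℂ) f := by
  obtain ⟨A, hA, hf⟩ := exists_differentiableOn_of_evalAt hP
  rw [UpperHalfPlane.mdifferentiable_iff]
  have h : DifferentiableOn ℂ (fun z : ℂ => A (cexp (2 * π * Complex.I * z))) {z | 0 < z.im} := by
    refine hA.comp (by fun_prop) fun z hz => ?_
    simpa [qexp] using norm_qexp_lt_one ⟨z, hz⟩
  refine h.congr fun z hz => ?_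
  rw [Function.comp_apply, hf, ofComplex_apply_of_im_pos hz]
  rfl

lemma isBoundedAtImInfty_of_evalAt {P : ℤ⟦X⟧} {f : ℍ → ℂ}
    (hP : ∀ τ, EvalAt P (qexp τ) (f τ)) : IsBoundedAtImInfty f := by
  refine isBoundedAtImInfty_of_hasSum_qExpansion (h := 1) one_pos
    (c := fun n => algebraMap ℤ ℂ (PowerSeries.coeff n P)) fun τ => ?_
  have h1 : Function.Periodic.qParam 1 τ = qexp τ := by
    simp [Function.Periodic.qParam, qexp]
  rw [h1]
  exact hP τ

lemma exists_eq_mul_S_mul_T {p : ℕ} (hp : p.Prime) {γ : SL(2, ℤ)} (hγ : γ ∉ Gamma0 p) :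
    ∃ δ ∈ Gamma0 p, ∃ j : ℤ, γ = δ * ModularGroup.S * ModularGroup.T ^ j := by
  have := Fact.mk hp
  rw [Gamma0_mem] at hγ
  obtain ⟨j, hj⟩ := ZMod.intCast_surjective ((γ 1 1 : ZMod p) / (γ 1 0 : ZMod p))
  refine ⟨γ * ModularGroup.T ^ (-j) * ModularGroup.S⁻¹, ?_, j, by simp⟩
  rw [Gamma0_mem]
  have : (γ * ModularGroup.T ^ (-j) * ModularGroup.S⁻¹) 1 0 = j * γ 1 0 - γ 1 1 := by
    simp only [Matrix.SpecialLinearGroup.coe_mul, ModularGroup.coe_T_zpow,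
      Matrix.SpecialLinearGroup.coe_inv, ModularGroup.coe_S, Matrix.adjugate_fin_two_of,
      Matrix.mul_apply, Fin.sum_univ_two]
    simp
    ring
  rw [this]
  push_cast
  rw [hj]
  field_simp
  ring

lemma isBoundedAtImInfty_slash_T_zpow {k : ℤ} {f : ℍ → ℂ} (hf : IsBoundedAtImInfty f) (j : ℤ) :
    IsBoundedAtImInfty (f ∣[k] (ModularGroup.T ^ j)) := by
  rw [isBoundedAtImInfty_iff] at hf ⊢
  obtain ⟨M, A, h⟩ := hf
  refine ⟨M, A, fun τ hτ => ?_⟩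
  have h1 : denom (ModularGroup.T ^ j : SL(2, ℤ)) τ = 1 := by
    rw [denom_eq_autFactor, autFactor, ModularGroup.coe_T_zpow]
    simp
  rw [ModularForm.SL_slash_apply, h1, one_zpow, mul_one, modular_T_zpow_smul]
  exact h _ (by simpa using hτ)

/-- Boundedness at all cusps from expansions at the two cusps `∞` and `0` of `Γ₀(p)`. -/
lemma isBoundedAtImInfty_slash {p k : ℕ} (hp : p.Prime) (hp0 : (0 : ℝ) < p) {F H : ℍ → ℂ}
    (hF : TransformsUnder (Gamma0 p) k F) (hF' : IsBoundedAtImInfty F)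
    (hH : IsBoundedAtImInfty H) (hFH : ∀ τ : ℍ, F (neginv (rscale p hp0 τ)) = τ ^ k * H τ)
    (γ : SL(2, ℤ)) : IsBoundedAtImInfty (F ∣[(k : ℤ)] γ) := by
  by_cases hγ : γ ∈ Gamma0 p
  · rwa [(slash_eq_iff k F γ).mpr (hF γ hγ)]
  obtain ⟨δ, hδ, j, rfl⟩ := exists_eq_mul_S_mul_T hp hγ
  rw [SlashAction.slash_mul, SlashAction.slash_mul, (slash_eq_iff k F δ).mpr (hF δ hδ)]
  refine isBoundedAtImInfty_slash_T_zpow ?_ j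
  rw [isBoundedAtImInfty_iff] at hH ⊢
  obtain ⟨M, A, h⟩ := hH
  refine ⟨‖((p : ℂ) ^ k)⁻¹‖ * M, p * A, fun τ hτ => ?_⟩
  have hp1 : (0 : ℝ) < (p : ℝ)⁻¹ := inv_pos.mpr hp0
  have hp2 : (p : ℂ) ≠ 0 := by exact_mod_cast hp0.ne'
  set σ := rscale (p : ℝ)⁻¹ hp1 τ with hσ
  have hτσ : τ = rscale p hp0 σ := by
    ext
    simp [hσ, rscale, hp2]
  have h3 : (τ : ℂ) = p * σ := by rw [hτσ]; simp [rscale]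
  have h1 : (F ∣[(k : ℤ)] ModularGroup.S) τ = ((p : ℂ) ^ k)⁻¹ * H σ := by
    have h2 : ModularGroup.S • τ = neginv (rscale p hp0 σ) := by
      rw [modular_S_smul, ← hτσ]
      rfl
    have := σ.ne_zero
    rw [ModularForm.SL_slash_apply, h2, hFH, ModularGroup.denom_S, h3, zpow_neg, zpow_natCast,
      mul_pow]
    field_simp
  rw [h1, norm_mul]
  refine mul_le_mul_of_nonneg_left (h σ ?_) (norm_nonneg _)
  have h4 : τ.im = p * σ.im := by
    rw [← coe_im, h3]
    simp
  rw [h4] at hτ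
  exact le_of_mul_le_mul_left hτ hp0

/-- A modular form on `Γ₀(p)` from expansions at the two cusps `∞` and `0`. -/
lemma exists_modularForm {p k : ℕ} (hp : p.Prime) (hp0 : (0 : ℝ) < p) {F H : ℍ → ℂ}
    {P Q : ℤ⟦X⟧} (hF : TransformsUnder (Gamma0 p) k F) (hP : ∀ τ, EvalAt P (qexp τ) (F τ))
    (hQ : ∀ τ, EvalAt Q (qexp τ) (H τ))
    (hFH : ∀ τ : ℍ, F (neginv (rscale p hp0 τ)) = τ ^ k * H τ) :
    ∃ f : ModularForm (Gamma0 p) (k : ℤ), ⇑f = F := by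
  have := NeZero.mk hp.ne_zero
  refine ⟨{ toFun := F, slash_action_eq' := ?_, holo' := mdifferentiable_of_evalAt hP,
            bdd_at_cusps' := fun {c} hc => ?_ }, rfl⟩
  · intro γ hγ
    obtain ⟨δ, hδ, rfl⟩ := Subgroup.mem_map.mp hγ
    exact (slash_eq_iff k F δ).mpr (hF δ hδ)
  · rw [Subgroup.IsArithmetic.isCusp_iff_isCusp_SL2Z] at hc
    rw [OnePoint.isBoundedAt_iff_forall_SL2Z hc]
    intro γ _
    exact isBoundedAtImInfty_slash hp hp0 hF (isBoundedAtImInfty_of_evalAt hP)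
      (isBoundedAtImInfty_of_evalAt hQ) hFH γ

lemma exists_modularForm_congruent {p k t M : ℕ} (hp : p.Prime) (ht : ((p : ℤ) - 1) * t = 12)
    (hk : k ∈ ({4, 6, 8, 10, 14} : Set ℕ)) (hM : 0 < M) {f₁ f₂ : WhmForm ⊤ (k : ℤ)}
    (hf₁ : IsBasisElt k 0 (p * M : ℕ) f₁) (hf₂ : IsBasisElt k 0 M f₂) {a₁ a₂ : ℤ → ℤ}
    (ha₁ : ∀ n : ℤ, 0 < n → f₁.coeff n = a₁ n) (ha₂ : ∀ n : ℤ, 0 < n → f₂.coeff n = a₂ n) :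
    ∃ (F : ModularForm (Gamma0 p) (k : ℤ)) (Q : ℤ⟦X⟧),
      ∀ τ, EvalAt (PowerSeries.mk (fun n => if n = 0 then 0 else a₁ n) -
        PowerSeries.expand p hp.ne_zero (PowerSeries.mk fun n => if n = 0 then 0 else a₂ n) -
        PowerSeries.C ((p : ℤ) ^ t) * (PowerSeries.X * Q)) (qexp τ) (F τ) := by
  have hp0 : (0 : ℝ) < p := by exact_mod_cast hp.pos
  obtain ⟨E, hE, PE, hPE1, hPE⟩ := exists_isNormalizedIntegral hk
  obtain ⟨⟨V, hV⟩, U, hU1, hU⟩ := exists_evalAt_etaQuot hp0 ht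
  have h₁ := WhmForm.evalAt_sub (Nat.mul_pos hp.pos hM) hf₁ ha₁
  have h₂ := WhmForm.evalAt_sub hM hf₂ ha₂
  set P₁ : ℤ⟦X⟧ := PowerSeries.mk fun n => if n = 0 then 0 else a₁ n
  set P₂ : ℤ⟦X⟧ := PowerSeries.mk fun n => if n = 0 then 0 else a₂ n
  have hexp : ∀ {P : ℤ⟦X⟧} {f : ℍ → ℂ}, (∀ τ, EvalAt P (qexp τ) (f τ)) → ∀ τ,
      EvalAt (PowerSeries.expand p hp.ne_zero P) (qexp τ) (f (rscale p hp0 τ)) := fun h τ =>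
    EvalAt.expand hp.ne_zero (by rw [← qexp_rscale hp0]; exact h _)
  obtain ⟨r, hr⟩ : ∃ r, p * (p * M) = M + r :=
    Nat.exists_eq_add_of_le <| (Nat.le_mul_of_pos_left M hp.pos).trans
      (Nat.le_mul_of_pos_left _ hp.pos)
  set h : ℍ → ℂ := fun τ => p ^ k * f₁.toFun (rscale p hp0 τ) - f₂.toFun τ
  obtain ⟨c, Q, hQ⟩ := exists_polynomial_sub (fun τ => qexp_ne_zero τ) hU1 hU hPE1 hPE
    (p * (p * M)) h
    (PowerSeries.C ((p : ℤ) ^ k) * (PowerSeries.X ^ (p * (p * M)) *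
        PowerSeries.expand p hp.ne_zero P₁ + 1) -
      (PowerSeries.X ^ (p * (p * M)) * P₂ + PowerSeries.X ^ r)) fun τ => by
    convert ((EvalAt.C ((p : ℤ) ^ k)).mul (((EvalAt.X.pow (p * (p * M))).mul
      (hexp h₁ τ)).add EvalAt.one)).sub
      (((EvalAt.X.pow (p * (p * M))).mul (h₂ τ)).add (EvalAt.X.pow r)) using 1
    have := qexp_ne_zero τ
    simp only [h, qexp_rscale, ← pow_mul, hr]
    simp
    field_simp
    ring
  have hF : TransformsUnder (Gamma0 p) k fun τ => f₁.toFun τ - f₂.toFun (rscale p hp0 τ) -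
      E (rscale p hp0 τ) * (Polynomial.X * c).aeval ((p : ℂ) ^ t * etaQuot hp0 t τ) :=
    ((f₁.transformsUnder.mono le_top).sub (f₂.transformsUnder.comp_rscale hp0)).sub <|
      (hE.comp_rscale hp0).mul (l := 0) fun γ hγ τ => by
        simp only [etaQuot_smul hp0 ht hγ, pow_zero, one_mul]
  have hP : ∀ τ, EvalAt (P₁ - PowerSeries.expand p hp.ne_zero P₂ - PowerSeries.C ((p : ℤ) ^ t) *
      (PowerSeries.X * (V * (PowerSeries.expand p hp.ne_zero PE *
        c.aeval (PowerSeries.C ((p : ℤ) ^ t) * (PowerSeries.X * V)))))) (qexp τ)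
      (f₁.toFun τ - f₂.toFun (rscale p hp0 τ) -
        E (rscale p hp0 τ) * (Polynomial.X * c).aeval ((p : ℂ) ^ t * etaQuot hp0 t τ)) := by
    intro τ
    have hY := (EvalAt.C ((p : ℤ) ^ t)).mul (hV τ)
    convert ((h₁ τ).sub (hexp h₂ τ)).sub ((hexp hPE τ).mul (hY.aeval (Polynomial.X * c))) using 1
    · simp only [map_mul, Polynomial.aeval_X]
      ring
    · simp only [qexp_rscale, ← pow_mul]
      simp
  obtain ⟨F, hF'⟩ := exists_modularForm hp hp0 hF hP hQ fun τ => by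
    simp only [f₁.transformsUnder.neginv, rscale_neginv_rscale, f₂.transformsUnder.neginv,
      hE.neginv, etaQuot_neginv_rscale, h]
    have h1 : ((rscale p hp0 τ : ℍ) : ℂ) = p * τ := by simp [rscale]
    rw [h1]
    ring
  exact ⟨F, _, fun τ => by rw [hF']; exact hP τ⟩

/-- `g(τ) = f_{k,mpˢ}(τ) - f_{k,mp^{s-1}}(pτ)` is congruent mod `p^{λ/2}` (with
`λ/2 = 12/(p-1)`) to a holomorphic form `F ∈ M_k(Γ₀(p))` with integer coefficients
vanishing at `∞`; here the `n`-th coefficient of `g` is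
`a1 n - a2 (n/p)` (the latter term present only when `p ∣ n`). -/
theorem stmt_16 (p : ℕ) (hp : p ∈ ({2, 3, 5, 7, 13} : Set ℕ)) (k : ℕ)
    (hk : k ∈ ({4, 6, 8, 10, 14} : Set ℕ)) (m : ℤ) (hm : 0 < m) (s : ℕ) (hs : 0 < s)
    (f1 f2 : WhmForm ⊤ (k : ℤ))
    (hf1 : IsBasisElt k 0 (m * p ^ s) f1)
    (hf2 : IsBasisElt k 0 (m * p ^ (s - 1)) f2)
    (a1 a2 : ℤ → ℤ)
    (ha1 : ∀ n : ℤ, 0 < n → f1.coeff n = (a1 n : ℂ))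
    (ha2 : ∀ n : ℤ, 0 < n → f2.coeff n = (a2 n : ℂ)) :
    ∃ (F : ModularForm (Gamma0 p) (k : ℤ)) (b : ℕ → ℤ),
      HasHoloExpansion (⇑F) (fun n => (b n : ℂ)) ∧ b 0 = 0 ∧
      ∀ n : ℕ, 0 < n →
        (p : ℤ) ^ (12 / (p - 1)) ∣
          (a1 n - (if (p : ℤ) ∣ (n : ℤ) then a2 ((n : ℤ) / p) else 0) - b n) := by
  have hp' : p.Prime ∧ ((p : ℤ) - 1) * (12 / (p - 1) : ℕ) = 12 := by
    rcases hp with rfl | rfl | rfl | rfl | rfl <;> norm_num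
  obtain ⟨hp, ht⟩ := hp'
  obtain ⟨m, rfl⟩ := Int.eq_ofNat_of_zero_le hm.le
  obtain ⟨s, rfl⟩ := Nat.exists_eq_add_of_le' hs
  rw [Nat.add_sub_cancel] at hf2
  have hM : 0 < m * p ^ s := Nat.mul_pos (by exact_mod_cast hm) (pow_pos hp.pos s)
  obtain ⟨F, Q, hF⟩ := exists_modularForm_congruent (M := m * p ^ s) hp ht hk hM
    (by convert hf1 using 1; push_cast; ring) (by exact_mod_cast hf2) ha1 ha2
  refine ⟨F, fun n => PowerSeries.coeff n _, hF, ?_, fun n hn => ?_⟩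
  · simp
  · beta_reduce
    rw [map_sub, map_sub, PowerSeries.coeff_C_mul, PowerSeries.coeff_mk, if_neg hn.ne']
    have : PowerSeries.coeff n (PowerSeries.expand p hp.ne_zero
        (PowerSeries.mk fun n => if n = 0 then 0 else a2 n)) =
        if (p : ℤ) ∣ n then a2 ((n : ℤ) / p) else 0 := by
      split_ifs with h
      · obtain ⟨j, rfl⟩ := Int.natCast_dvd_natCast.mp h
        have hj : j ≠ 0 := by rintro rfl; simp at hn
        rw [PowerSeries.coeff_expand_mul, PowerSeries.coeff_mk, if_neg hj, Nat.cast_mul,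
          Int.mul_ediv_cancel_left _ (by exact_mod_cast hp.ne_zero)]
      · exact PowerSeries.coeff_expand_of_not_dvd _ _ _ (by exact_mod_cast h)
    rw [this]
    rw [sub_sub_cancel]
    exact dvd_mul_right _ _
end
end
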